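/- arXiv:1603.01697 — 2 statements merged into one kernel-verified Lean document; each statement's English description precedes it below -/
import Mathlib

section
/- Let the complete 4-uniform hypergraph K^4_l be 2-edge colored red and blue, and let P = e_1e_2…e_n with n ≥ 2 be a red loose path that is maximal with respect to a set W ⊆ V(K^4_l) \ V(P) with |W| ≥ 4. Then there exist an integer r ≥ 0, a subset W' ⊆ W, and two vertex-disjoint blue loose paths Q and Q' such that: (i) Q has at least 2 edges; (ii) the total number of edges of Q and Q' equals n − r, and this number equals 2(|W'| − 2) if Q' has at least one edge and equals 2(|W'| − 1) if Q' has no edges; (iii) every edge e of Q or Q' intersects W' in exactly one vertex, which is an end vertex (the first or last vertex) of e in its path, and the remaining vertices of e lie in the truncated path P̄ = e_1e_2…e_{n−r}; (iv) at least one vertex of e_{n−r} \ e_{n−r−1} lies in neither V(Q) nor V(Q'); and (v) writing x = |W \ W'|: if Q' has no edges then x ∈ {1,2} or (x ≥ 3 and 0 ≤ r ≤ 1), while if Q' has at least one edge then x = 0 or (x ≥ 1 and 0 ≤ r ≤ 1). -/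
/-- The `i`-th edge (0-indexed) of the 4-uniform loose path listed by `g`:
the 4-set `{g (3*i), g (3*i+1), g (3*i+2), g (3*i+3)}`. -/
def pathEdge {V : Type*} [DecidableEq V] (g : ℕ → V) (i : ℕ) : Finset V :=
  (Finset.range 4).image fun j => g (3 * i + j)

/-- The vertex set of the 4-uniform loose path of length `n` listed by `g`. -/
def pathVerts {V : Type*} (g : ℕ → V) (n : ℕ) : Set V :=
  g '' Set.Iio (3 * n + 1)

/-- `g` lists a 4-uniform loose path with `n` edges, all of color `b`
(`true` = red, `false` = blue) in the coloring `col`. -/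
def IsLoosePath4 {V : Type*} [DecidableEq V] (col : Finset V → Bool) (b : Bool)
    (g : ℕ → V) (n : ℕ) : Prop :=
  Set.InjOn g (Set.Iio (3 * n + 1)) ∧ ∀ i < n, col (pathEdge g i) = b

/-- The red loose path `P = e_1 … e_n` listed by `g` is maximal with respect to `W`:
there is no red loose path `P' = e_1 … e_{i-1} e'_i … e'_{i+r} e_{i+r} … e_n` with
`n+1` edges (here `1 ≤ r ≤ n`, `1 ≤ i ≤ n - r + 1`, indices of edges 1-based) such that
`V(P') = V(P) ∪ W'` for some `W' ⊆ W`, and moreover if `i = 1` then the first vertex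
of `P'` equals the first vertex of `P`, and if `i + r - 1 = n` then the last vertex
of `P'` equals the last vertex of `P`. -/
def MaximalWrt {V : Type*} [DecidableEq V] (col : Finset V → Bool)
    (g : ℕ → V) (n : ℕ) (W : Set V) : Prop :=
  ¬ ∃ (g' : ℕ → V) (r i : ℕ), 1 ≤ r ∧ r ≤ n ∧ 1 ≤ i ∧ i ≤ n - r + 1 ∧
      IsLoosePath4 col true g' (n + 1) ∧
      (∀ j, j + 1 < i → pathEdge g' j = pathEdge g j) ∧
      (∀ j, i + r - 1 ≤ j → j < n → pathEdge g' (j + 1) = pathEdge g j) ∧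
      pathVerts g n ⊆ pathVerts g' (n + 1) ∧
      pathVerts g' (n + 1) ⊆ pathVerts g n ∪ W ∧
      (i = 1 → g' 0 = g 0) ∧
      (i + r - 1 = n → g' (3 * (n + 1)) = g (3 * n))

def perm3 (n m pos a b c d e : ℕ) (j : ℕ) : ℕ :=
  if j ≤ 3 * m then (if j = pos then 3 * m else if j = 3 * m then pos else j)
  else if j = 3 * m + 1 then 3 * m + a
  else if j = 3 * m + 2 then 3 * n + 1
  else if j = 3 * m + 3 then 3 * m + b
  else if j = 3 * m + 4 then 3 * m + c
  else if j = 3 * m + 5 then 3 * n + 2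
  else if j = 3 * m + 6 then 3 * m + d
  else if j = 3 * m + 7 then 3 * m + e
  else if j = 3 * m + 8 then 3 * n + 3
  else j - 3

def inv3 (n m pos a b c d e : ℕ) (j : ℕ) : ℕ :=
  if j ≤ 3 * m then (if j = pos then 3 * m else if j = 3 * m then pos else j)
  else if j = 3 * n + 1 then 3 * m + 2
  else if j = 3 * n + 2 then 3 * m + 5
  else if j = 3 * n + 3 then 3 * m + 8
  else if j = 3 * m + a then 3 * m + 1
  else if j = 3 * m + b then 3 * m + 3
  else if j = 3 * m + c then 3 * m + 4
  else if j = 3 * m + d then 3 * m + 6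
  else if j = 3 * m + e then 3 * m + 7
  else j + 3

structure Ord5 (a b c d e : ℕ) : Prop where
  ha : 1 ≤ a ∧ a ≤ 5
  hb : 1 ≤ b ∧ b ≤ 5
  hc : 1 ≤ c ∧ c ≤ 5
  hd : 1 ≤ d ∧ d ≤ 5
  he : 1 ≤ e ∧ e ≤ 5
  hab : b ≠ a
  hac : c ≠ a ∧ c ≠ b
  had : d ≠ a ∧ d ≠ b ∧ d ≠ c
  hae : e ≠ a ∧ e ≠ b ∧ e ≠ c ∧ e ≠ d
  hs : ∀ i, 1 ≤ i → i ≤ 5 → i = a ∨ i = b ∨ i = c ∨ i = d ∨ i = e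

lemma perm3_vals (n m pos a b c d e : ℕ) (hpos : pos ≤ 3 * m) :
    perm3 n m pos a b c d e (3 * m) = pos ∧
    perm3 n m pos a b c d e (3 * m + 1) = 3 * m + a ∧
    perm3 n m pos a b c d e (3 * m + 2) = 3 * n + 1 ∧
    perm3 n m pos a b c d e (3 * m + 3) = 3 * m + b ∧
    perm3 n m pos a b c d e (3 * m + 4) = 3 * m + c ∧
    perm3 n m pos a b c d e (3 * m + 5) = 3 * n + 2 ∧
    perm3 n m pos a b c d e (3 * m + 6) = 3 * m + d ∧
    perm3 n m pos a b c d e (3 * m + 7) = 3 * m + e ∧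
    perm3 n m pos a b c d e (3 * m + 8) = 3 * n + 3 := by
  refine ⟨?_, ?_, ?_, ?_, ?_, ?_, ?_, ?_, ?_⟩ <;> simp [perm3]

lemma perm3_big (n m pos a b c d e : ℕ) (j : ℕ) (hj : 3 * m + 6 ≤ j) :
    perm3 n m pos a b c d e (j + 3) = j := by
  unfold perm3
  rw [if_neg (by omega), if_neg (by omega), if_neg (by omega), if_neg (by omega),
    if_neg (by omega), if_neg (by omega), if_neg (by omega), if_neg (by omega),
    if_neg (by omega)]
  omega

lemma perm3_small (n m pos a b c d e : ℕ) (j : ℕ) (hj : j ≤ 3 * m) :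
    perm3 n m pos a b c d e j = if j = pos then 3 * m else if j = 3 * m then pos else j := by
  unfold perm3
  rw [if_pos hj]

lemma inv3_small (n m pos a b c d e : ℕ) (j : ℕ) (hj : j ≤ 3 * m) :
    inv3 n m pos a b c d e j = if j = pos then 3 * m else if j = 3 * m then pos else j := by
  unfold inv3
  rw [if_pos hj]

lemma inv3_w (n m pos a b c d e : ℕ) (hm : m + 2 ≤ n) :
    inv3 n m pos a b c d e (3 * n + 1) = 3 * m + 2 ∧
    inv3 n m pos a b c d e (3 * n + 2) = 3 * m + 5 ∧
    inv3 n m pos a b c d e (3 * n + 3) = 3 * m + 8 := by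
  unfold inv3
  refine ⟨?_, ?_, ?_⟩
  · rw [if_neg (by omega), if_pos rfl]
  · rw [if_neg (by omega), if_neg (by omega), if_pos rfl]
  · rw [if_neg (by omega), if_neg (by omega), if_neg (by omega), if_pos rfl]

lemma inv3_mid (n m pos a b c d e : ℕ) (hm : m + 2 ≤ n) (j : ℕ) (hj : 1 ≤ j) (hj' : j ≤ 5) :
    inv3 n m pos a b c d e (3 * m + j) = if j = a then 3 * m + 1 else if j = b then 3 * m + 3
      else if j = c then 3 * m + 4 else if j = d then 3 * m + 6 else if j = e then 3 * m + 7
      else 3 * m + j + 3 := by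
  unfold inv3
  rw [if_neg (by omega), if_neg (by omega), if_neg (by omega), if_neg (by omega)]
  simp only [Nat.add_left_cancel_iff]

lemma inv3_big {n m pos a b c d e : ℕ} (h : Ord5 a b c d e) (j : ℕ) (hj : 3 * m + 6 ≤ j)
    (hj' : j ≤ 3 * n) :
    inv3 n m pos a b c d e j = j + 3 := by
  obtain ⟨ha, hb, hc, hd, he, -, -, -, -, -⟩ := h
  unfold inv3
  rw [if_neg (by omega), if_neg (by omega), if_neg (by omega), if_neg (by omega),
    if_neg (by omega), if_neg (by omega), if_neg (by omega), if_neg (by omega), if_neg (by omega)]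

lemma swapif (M pos j : ℕ) : (if (if j = pos then M else if j = M then pos else j) = pos then M else
    if (if j = pos then M else if j = M then pos else j) = M then pos else
    (if j = pos then M else if j = M then pos else j)) = j := by
  split_ifs <;> omega

lemma swapif_le (M pos j : ℕ) (hj : j ≤ M) (hp : pos ≤ M) :
    (if j = pos then M else if j = M then pos else j) ≤ M := by
  split_ifs <;> omega

lemma cases3 (n m j : ℕ) (hj : j ≤ 3 * n + 3) : j ≤ 3 * m ∨ j = 3 * m + 1 ∨ j = 3 * m + 2 ∨
    j = 3 * m + 3 ∨ j = 3 * m + 4 ∨ j = 3 * m + 5 ∨ j = 3 * m + 6 ∨ j = 3 * m + 7 ∨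
    j = 3 * m + 8 ∨ ∃ k, 3 * m + 6 ≤ k ∧ k ≤ 3 * n ∧ j = k + 3 := by
  by_cases h : 3 * m + 9 ≤ j
  · iterate 9 right
    exact ⟨j - 3, by omega, by omega, by omega⟩
  · omega

lemma inv3_perm3 {n m pos a b c d e : ℕ} (hm : m + 2 ≤ n) (hpos : pos ≤ 3 * m)
    (h : Ord5 a b c d e) (j : ℕ) (hj : j ≤ 3 * n + 3) :
    inv3 n m pos a b c d e (perm3 n m pos a b c d e j) = j := by
  obtain ⟨-, e1, e2, e3, e4, e5, e6, e7, e8⟩ := perm3_vals n m pos a b c d e hpos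
  obtain ⟨i1, i2, i3⟩ := inv3_w n m pos a b c d e hm
  have M := inv3_mid n m pos a b c d e hm
  obtain ⟨ha, hb, hc, hd, he, hab, hac, had, hae, -⟩ := id h
  rcases cases3 n m j hj with h0 | rfl | rfl | rfl | rfl | rfl | rfl | rfl | rfl | ⟨k, hk, hk', rfl⟩
  · rw [perm3_small _ _ _ _ _ _ _ _ _ h0,
      inv3_small _ _ _ _ _ _ _ _ _ (swapif_le _ _ _ h0 hpos), swapif]
  · rw [e1, M a ha.1 ha.2, if_pos rfl]
  · rw [e2, i1]
  · rw [e3, M b hb.1 hb.2, if_neg hab, if_pos rfl]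
  · rw [e4, M c hc.1 hc.2, if_neg hac.1, if_neg hac.2, if_pos rfl]
  · rw [e5, i2]
  · rw [e6, M d hd.1 hd.2, if_neg had.1, if_neg had.2.1, if_neg had.2.2, if_pos rfl]
  · rw [e7, M e he.1 he.2, if_neg hae.1, if_neg hae.2.1, if_neg hae.2.2.1, if_neg hae.2.2.2,
      if_pos rfl]
  · rw [e8, i3]
  · rw [perm3_big _ _ _ _ _ _ _ _ _ hk, inv3_big h _ hk hk']

lemma perm3_inv3 {n m pos a b c d e : ℕ} (hm : m + 2 ≤ n) (hpos : pos ≤ 3 * m)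
    (h : Ord5 a b c d e) (j : ℕ) (hj : j ≤ 3 * n) :
    perm3 n m pos a b c d e (inv3 n m pos a b c d e j) = j := by
  obtain ⟨-, e1, e2, e3, e4, e5, e6, e7, e8⟩ := perm3_vals n m pos a b c d e hpos
  have M := inv3_mid n m pos a b c d e hm
  by_cases h0 : j ≤ 3 * m
  · rw [inv3_small _ _ _ _ _ _ _ _ _ h0,
      perm3_small _ _ _ _ _ _ _ _ _ (swapif_le _ _ _ h0 hpos), swapif]
  by_cases h6 : 3 * m + 6 ≤ j
  · rw [inv3_big h _ h6 hj, perm3_big _ _ _ _ _ _ _ _ _ h6]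
  obtain ⟨k, rfl⟩ : ∃ k, j = 3 * m + k := ⟨j - 3 * m, by omega⟩
  have hs := h.hs k (by omega) (by omega)
  rw [M k (by omega) (by omega)]
  split_ifs with q1 q2 q3 q4 q5
  · rw [e1, q1]
  · rw [e3, q2]
  · rw [e4, q3]
  · rw [e6, q4]
  · rw [e7, q5]
  · exfalso; tauto

lemma perm3_le {n m pos a b c d e : ℕ} (hm : m + 2 ≤ n) (hpos : pos ≤ 3 * m)
    (h : Ord5 a b c d e) (j : ℕ) (hj : j ≤ 3 * n + 3) :
    perm3 n m pos a b c d e j ≤ 3 * n + 3 := by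
  obtain ⟨ha, hb, hc, hd, he, -, -, -, -, -⟩ := h
  unfold perm3
  split_ifs <;> omega

lemma inv3_le {n m pos a b c d e : ℕ} (hm : m + 2 ≤ n) (hpos : pos ≤ 3 * m)
    (j : ℕ) (hj : j ≤ 3 * n) :
    inv3 n m pos a b c d e j ≤ 3 * n + 3 := by
  unfold inv3
  split_ifs <;> omega

def extw {V : Type*} (g : ℕ → V) (n : ℕ) (w1 w2 w3 : V) (j : ℕ) : V :=
  if j ≤ 3 * n then g j else if j = 3 * n + 1 then w1 else if j = 3 * n + 2 then w2 else w3

lemma pathEdge_eq {V : Type*} [DecidableEq V] (g : ℕ → V) (i : ℕ) :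
    pathEdge g i = {g (3 * i), g (3 * i + 1), g (3 * i + 2), g (3 * i + 3)} := by
  ext v
  simp only [pathEdge, Finset.mem_image, Finset.mem_range, Finset.mem_insert,
    Finset.mem_singleton]
  constructor
  · rintro ⟨j, hj, rfl⟩
    interval_cases j <;> simp
  · rintro (h | h | h | h)
    · exact ⟨0, by omega, h.symm⟩
    · exact ⟨1, by omega, h.symm⟩
    · exact ⟨2, by omega, h.symm⟩
    · exact ⟨3, by omega, h.symm⟩

lemma mem_pathVerts {V : Type*} {g : ℕ → V} {n : ℕ} {v : V} :
    v ∈ pathVerts g n ↔ ∃ j, j ≤ 3 * n ∧ g j = v := by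
  simp only [pathVerts, Set.mem_image, Set.mem_Iio]
  constructor
  · rintro ⟨j, h, e⟩; exact ⟨j, by omega, e⟩
  · rintro ⟨j, h, e⟩; exact ⟨j, by omega, e⟩

def locP {V : Type*} (g : ℕ → V) (m pos : ℕ) (i : ℕ) : V :=
  if i = 0 then g pos else g (3 * m + i)

lemma extw_inj {V : Type*} [DecidableEq V] {n : ℕ} {col : Finset V → Bool} {g : ℕ → V}
    (hP : IsLoosePath4 col true g n) {W : Finset V} (hWP : ∀ w ∈ W, w ∉ pathVerts g n)
    {w1 w2 w3 : V} (h1 : w1 ∈ W) (h2 : w2 ∈ W) (h3 : w3 ∈ W)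
    (h12 : w2 ≠ w1) (h13 : w3 ≠ w1) (h23 : w3 ≠ w2) {i j : ℕ} (hi : i ≤ 3 * n + 3)
    (hj : j ≤ 3 * n + 3) (h : extw g n w1 w2 w3 i = extw g n w1 w2 w3 j) : i = j := by
  have key : ∀ w ∈ W, ∀ k, k ≤ 3 * n → g k ≠ w := fun w hw k hk he =>
    hWP w hw (mem_pathVerts.2 ⟨k, hk, he⟩)
  have hinj : ∀ i j, i ≤ 3 * n → j ≤ 3 * n → g i = g j → i = j := fun i j hi hj he =>
    hP.1 (Set.mem_Iio.2 (by omega)) (Set.mem_Iio.2 (by omega)) he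
  unfold extw at h
  split_ifs at h <;> first | omega | exact hinj _ _ (by assumption) (by assumption) h | grind

set_option maxHeartbeats 1000000 in
lemma noRed {V : Type*} [DecidableEq V] {n : ℕ} {col : Finset V → Bool} {g : ℕ → V}
    (hP : IsLoosePath4 col true g n) {W : Finset V} (hWP : ∀ w ∈ W, w ∉ pathVerts g n)
    (hmax : MaximalWrt col g n ↑W) {m pos : ℕ} (hm : m + 2 ≤ n) (hpos : pos ≤ 3 * m)
    (hpos2 : 3 * m ≤ pos + 2) {a b c d e : ℕ} (h : Ord5 a b c d e)
    {w1 w2 w3 : V} (h1 : w1 ∈ W) (h2 : w2 ∈ W) (h3 : w3 ∈ W)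
    (h12 : w2 ≠ w1) (h13 : w3 ≠ w1) (h23 : w3 ≠ w2)
    (c1 : col {locP g m pos 0, locP g m pos a, locP g m pos b, w1} = true)
    (c2 : col {locP g m pos b, locP g m pos c, locP g m pos d, w2} = true)
    (c3 : col {locP g m pos d, locP g m pos e, locP g m pos 6, w3} = true) : False := by
  apply hmax
  have hlo : ∀ i, 1 ≤ i → i ≤ 6 → extw g n w1 w2 w3 (3 * m + i) = locP g m pos i := by
    intro i hi hi'
    unfold extw locP
    rw [if_pos (by omega), if_neg (by omega)]
  have hlo0 : extw g n w1 w2 w3 pos = locP g m pos 0 := by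
    unfold extw locP
    rw [if_pos (by omega), if_pos rfl]
  have hw1 : extw g n w1 w2 w3 (3 * n + 1) = w1 := by simp [extw]
  have hw2 : extw g n w1 w2 w3 (3 * n + 2) = w2 := by simp [extw]
  have hw3 : extw g n w1 w2 w3 (3 * n + 3) = w3 := by simp [extw]
  have hg : ∀ j, j ≤ 3 * n → extw g n w1 w2 w3 j = g j := by
    intro j hj; unfold extw; rw [if_pos hj]
  obtain ⟨e0, e1, e2, e3, e4, e5, e6, e7, e8⟩ := perm3_vals n m pos a b c d e hpos
  have e9 : ∀ j, 3 * m + 6 ≤ j → perm3 n m pos a b c d e (j + 3) = j :=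
    perm3_big n m pos a b c d e
  have elt : ∀ j, j + 2 < 3 * m → perm3 n m pos a b c d e j = j := by
    intro j hj
    rw [perm3_small _ _ _ _ _ _ _ _ _ (by omega), if_neg (by omega), if_neg (by omega)]
  obtain ⟨G, hG⟩ : ∃ G : ℕ → V, ∀ j, G j = extw g n w1 w2 w3 (perm3 n m pos a b c d e j) :=
    ⟨_, fun _ => rfl⟩
  have hhead : ∀ j, j < m → pathEdge G j = pathEdge g j := by
    intro j hj
    rw [pathEdge_eq, pathEdge_eq, hG, hG, hG, hG]
    rw [elt (3 * j) (by omega)]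
    by_cases hjm : j + 1 = m
    · obtain ⟨q, hq, hq3⟩ : ∃ q, pos = 3 * j + 1 + q ∧ q ≤ 2 := ⟨pos - (3 * j + 1), by omega, by omega⟩
      subst hjm
      have E : ∀ i, 1 ≤ i → i ≤ 3 → extw g n w1 w2 w3 (3 * j + i) = g (3 * j + i) := by
        intro i _ _; exact hg _ (by omega)
      rw [hg (3 * j) (by omega)]
      interval_cases q
      · rw [show perm3 n (j+1) pos a b c d e (3 * j + 1) = 3 * j + 3 by
          rw [perm3_small _ _ _ _ _ _ _ _ _ (by omega)]; split_ifs <;> omega,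
          show perm3 n (j+1) pos a b c d e (3 * j + 2) = 3 * j + 2 by
          rw [perm3_small _ _ _ _ _ _ _ _ _ (by omega)]; split_ifs <;> omega,
          show perm3 n (j+1) pos a b c d e (3 * j + 3) = 3 * j + 1 by
          rw [perm3_small _ _ _ _ _ _ _ _ _ (by omega)]; split_ifs <;> omega, E 1 (by omega) (by omega),
          E 2 (by omega) (by omega), E 3 (by omega) (by omega)]
        ext v; simp only [Finset.mem_insert, Finset.mem_singleton]; tauto
      · rw [show perm3 n (j+1) pos a b c d e (3 * j + 1) = 3 * j + 1 by
          rw [perm3_small _ _ _ _ _ _ _ _ _ (by omega)]; split_ifs <;> omega,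
          show perm3 n (j+1) pos a b c d e (3 * j + 2) = 3 * j + 3 by
          rw [perm3_small _ _ _ _ _ _ _ _ _ (by omega)]; split_ifs <;> omega,
          show perm3 n (j+1) pos a b c d e (3 * j + 3) = 3 * j + 2 by
          rw [perm3_small _ _ _ _ _ _ _ _ _ (by omega)]; split_ifs <;> omega, E 1 (by omega) (by omega),
          E 2 (by omega) (by omega), E 3 (by omega) (by omega)]
        ext v; simp only [Finset.mem_insert, Finset.mem_singleton]; tauto
      · rw [show perm3 n (j+1) pos a b c d e (3 * j + 1) = 3 * j + 1 by
          rw [perm3_small _ _ _ _ _ _ _ _ _ (by omega)]; split_ifs <;> omega,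
          show perm3 n (j+1) pos a b c d e (3 * j + 2) = 3 * j + 2 by
          rw [perm3_small _ _ _ _ _ _ _ _ _ (by omega)]; split_ifs <;> omega,
          show perm3 n (j+1) pos a b c d e (3 * j + 3) = 3 * j + 3 by
          rw [perm3_small _ _ _ _ _ _ _ _ _ (by omega)]; split_ifs <;> omega, E 1 (by omega) (by omega),
          E 2 (by omega) (by omega), E 3 (by omega) (by omega)]
    · rw [elt _ (by omega), elt _ (by omega), elt _ (by omega), hg _ (by omega), hg _ (by omega),
        hg _ (by omega), hg _ (by omega)]
  have htail : ∀ j, m + 2 ≤ j → j < n → pathEdge G (j + 1) = pathEdge g j := by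
    intro j hj hjn
    rw [pathEdge_eq, pathEdge_eq, hG, hG, hG, hG]
    rw [show 3 * (j + 1) = 3 * j + 3 by ring, e9 _ (by omega),
      show 3 * j + 3 + 1 = (3 * j + 1) + 3 by ring, e9 _ (by omega),
      show 3 * j + 3 + 2 = (3 * j + 2) + 3 by ring, e9 _ (by omega), e9 _ (by omega),
      hg _ (by omega), hg _ (by omega), hg _ (by omega), hg _ (by omega)]
  refine ⟨G, 2, m + 1, by omega, by omega, by omega, by omega, ⟨?_, ?_⟩, ?_, ?_, ?_, ?_, ?_, ?_⟩
  · intro i hi j hj hij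
    have hi' : i ≤ 3 * n + 3 := by have := Set.mem_Iio.1 hi; omega
    have hj' : j ≤ 3 * n + 3 := by have := Set.mem_Iio.1 hj; omega
    rw [hG, hG] at hij
    have := extw_inj hP hWP h1 h2 h3 h12 h13 h23 (perm3_le hm hpos h i hi')
      (perm3_le hm hpos h j hj') hij
    rw [← inv3_perm3 hm hpos h i hi', this, inv3_perm3 hm hpos h j hj']
  · intro j hj
    by_cases hj1 : j < m
    · rw [hhead j hj1]; exact hP.2 j (by omega)
    by_cases hj2 : m + 3 ≤ j
    · obtain ⟨k, rfl⟩ : ∃ k, j = k + 1 := ⟨j - 1, by omega⟩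
      rw [htail k (by omega) (by omega)]; exact hP.2 k (by omega)
    obtain rfl | rfl | rfl : j = m ∨ j = m + 1 ∨ j = m + 2 := by omega
    · rw [pathEdge_eq, hG, hG, hG, hG, e0, e1, e2, e3, hlo0, hlo a h.ha.1 (by have := h.ha; omega),
        hw1, hlo b h.hb.1 (by have := h.hb; omega), ← c1]
      congr 1
      ext v; simp only [Finset.mem_insert, Finset.mem_singleton]; tauto
    · rw [pathEdge_eq, hG, hG, hG, hG, show 3 * (m + 1) = 3 * m + 3 by ring, e3, e4, e5, e6,
        hlo c h.hc.1 (by have := h.hc; omega), hw2, hlo d h.hd.1 (by have := h.hd; omega),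
        hlo b h.hb.1 (by have := h.hb; omega), ← c2]
      congr 1
      ext v; simp only [Finset.mem_insert, Finset.mem_singleton]; tauto
    · rw [pathEdge_eq, hG, hG, hG, hG, show 3 * (m + 2) = 3 * m + 6 by ring, e6, e7, e8,
        e9 (3 * m + 6) (by omega), hlo 6 (by omega) (by omega),
        hlo d h.hd.1 (by have := h.hd; omega), hw3, hlo e h.he.1 (by have := h.he; omega), ← c3]
      congr 1
      ext v; simp only [Finset.mem_insert, Finset.mem_singleton]; tauto
  · intro j hj; exact hhead j (by omega)
  · intro j hj hjn; exact htail j (by omega) hjn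
  · intro v hv
    obtain ⟨j, hj, rfl⟩ := mem_pathVerts.1 hv
    refine mem_pathVerts.2 ⟨inv3 n m pos a b c d e j, ?_, ?_⟩
    · have := inv3_le (a := a) (b := b) (c := c) (d := d) (e := e) hm hpos j hj; omega
    · rw [hG, perm3_inv3 hm hpos h j hj, hg j hj]
  · intro v hv
    obtain ⟨j, hj, rfl⟩ := mem_pathVerts.1 hv
    rw [hG]
    unfold extw
    split_ifs with q1 q2 q3
    · exact Or.inl (mem_pathVerts.2 ⟨_, q1, rfl⟩)
    · exact Or.inr h1
    · exact Or.inr h2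
    · exact Or.inr h3
  · intro hi
    have hm0 : m = 0 := by omega
    subst hm0
    have : pos = 0 := by omega
    subst this
    rw [hG, show (0 : ℕ) = 3 * 0 by rfl, e0, hg _ (by omega)]
  · intro hi
    rw [hG, show 3 * (n + 1) = 3 * n + 3 by ring, e9 _ (by omega), hg _ (by omega)]

def redSet {V : Type*} [DecidableEq V] (col : Finset V → Bool) (T : Finset V) (p : ℕ → V)
    (a b c : ℕ) : Finset V :=
  T.filter (fun w => col {p a, p b, p c, w} = true)

lemma redSet_swap1 {V : Type*} [DecidableEq V] (col : Finset V → Bool) (T : Finset V) (p : ℕ → V)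
    (a b c : ℕ) : redSet col T p a b c = redSet col T p b a c := by
  unfold redSet
  congr 1; ext w
  rw [Finset.insert_comm]

lemma redSet_swap2 {V : Type*} [DecidableEq V] (col : Finset V → Bool) (T : Finset V) (p : ℕ → V)
    (a b c : ℕ) : redSet col T p a b c = redSet col T p a c b := by
  unfold redSet
  congr 1; ext w
  rw [Finset.insert_comm (p b)]

lemma clause {V : Type*} [DecidableEq V] {n : ℕ} {col : Finset V → Bool} {g : ℕ → V}
    (hP : IsLoosePath4 col true g n) {W : Finset V} (hWP : ∀ w ∈ W, w ∉ pathVerts g n)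
    (hmax : MaximalWrt col g n ↑W) {m pos : ℕ} (hm : m + 2 ≤ n) (hpos : pos ≤ 3 * m)
    (hpos2 : 3 * m ≤ pos + 2) {T : Finset V} (hT : T ⊆ W) {a b c d e : ℕ} (h : Ord5 a b c d e) :
    (redSet col T (locP g m pos) 0 a b).card ≤ 2 ∨ (redSet col T (locP g m pos) b c d).card ≤ 2 ∨
      (redSet col T (locP g m pos) d e 6).card ≤ 2 := by
  by_contra! hcon
  obtain ⟨k1, k2, k3⟩ := hcon
  obtain ⟨w1, hw1⟩ : (redSet col T (locP g m pos) 0 a b).Nonempty :=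
    Finset.card_pos.1 (by omega)
  obtain ⟨w2, hw2, h12⟩ := Finset.exists_mem_notMem_of_card_lt_card
    (s := {w1}) (t := redSet col T (locP g m pos) b c d) (by rw [Finset.card_singleton]; omega)
  obtain ⟨w3, hw3, h123⟩ := Finset.exists_mem_notMem_of_card_lt_card
    (s := {w1, w2}) (t := redSet col T (locP g m pos) d e 6)
    (lt_of_le_of_lt Finset.card_le_two k3)
  simp only [Finset.mem_insert, Finset.mem_singleton, not_or] at h12 h123
  simp only [redSet, Finset.mem_filter] at hw1 hw2 hw3
  exact noRed hP hWP hmax hm hpos hpos2 h (hT hw1.1) (hT hw2.1) (hT hw3.1) h12 h123.1 h123.2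
    hw1.2 hw2.2 hw3.2

structure Good6 (a b c d e f : ℕ) : Prop where
  lt : a < 7 ∧ b < 7 ∧ c < 7 ∧ d < 7 ∧ e < 7 ∧ f < 7
  hf : 4 ≤ f
  h1 : a ≠ b ∧ a ≠ c ∧ a ≠ d ∧ a ≠ e ∧ a ≠ f
  h2 : b ≠ c ∧ b ≠ d ∧ b ≠ e ∧ b ≠ f
  h3 : c ≠ d ∧ c ≠ e ∧ c ≠ f
  h4 : d ≠ e ∧ d ≠ f ∧ e ≠ f

lemma core (B : ℕ → ℕ → ℕ → Prop) (s1 : ∀ a b c, B a b c → B b a c)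
    (s2 : ∀ a b c, B a b c → B a c b)
    (hcl : ∀ a b c d e, Ord5 a b c d e → B 0 a b ∨ B b c d ∨ B d e 6) :
    ∃ a b c d e f, Good6 a b c d e f ∧ B a b c ∧ B c d e := by
  by_contra hcon
  have hp : ∀ a b c d e f, Good6 a b c d e f → B a b c → B c d e → False := fun a b c d e f h h1 h2 =>
    hcon ⟨a, b, c, d, e, f, h, h1, h2⟩
  have c1 : B 0 3 5 ∨ B 2 3 4 ∨ B 1 2 6 := by
    rcases hcl 5 3 4 2 1 (by constructor <;> first | decide | (intro i _ _; omega)) with h | h | h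
    · exact Or.inl (s2 _ _ _ h)
    · exact Or.inr (Or.inl (s1 _ _ _ (s2 _ _ _ h)))
    · exact Or.inr (Or.inr (s1 _ _ _ h))
  have c2 : B 0 3 5 ∨ B 1 2 5 ∨ B 1 4 6 := by
    rcases hcl 3 5 2 1 4 (by constructor <;> first | decide | (intro i _ _; omega)) with h | h | h
    · exact Or.inl h
    · exact Or.inr (Or.inl (s1 _ _ _ (s2 _ _ _ (s1 _ _ _ h))))
    · exact Or.inr (Or.inr h)
  have c3 : B 0 1 4 ∨ B 1 2 3 ∨ B 3 5 6 := by
    rcases hcl 4 1 2 3 5 (by constructor <;> first | decide | (intro i _ _; omega)) with h | h | h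
    · exact Or.inl (s2 _ _ _ h)
    · exact Or.inr (Or.inl h)
    · exact Or.inr (Or.inr h)
  have c4 : B 0 2 3 ∨ B 2 4 5 ∨ B 1 5 6 := by
    rcases hcl 3 2 4 5 1 (by constructor <;> first | decide | (intro i _ _; omega)) with h | h | h
    · exact Or.inl (s2 _ _ _ h)
    · exact Or.inr (Or.inl h)
    · exact Or.inr (Or.inr (s1 _ _ _ h))
  -- rotations
  have r1 : ∀ a b c, B a b c → B b c a := fun a b c h => s2 _ _ _ (s1 _ _ _ h)
  have r2 : ∀ a b c, B a b c → B c a b := fun a b c h => s1 _ _ _ (s2 _ _ _ h)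
  have n1 : B 0 1 4 → B 0 3 5 → False := fun x y =>
    hp 1 4 0 3 5 6 (by constructor <;> decide) (r1 _ _ _ x) y
  have n2 : B 0 1 4 → B 1 2 6 → False := fun x y =>
    hp 4 0 1 2 6 5 (by constructor <;> decide) (r2 _ _ _ x) y
  have n3 : B 0 2 3 → B 1 2 6 → False := fun x y =>
    hp 0 3 2 1 6 5 (by constructor <;> decide) (s2 _ _ _ x) (s1 _ _ _ y)
  have n4 : B 0 2 3 → B 3 5 6 → False := fun x y =>
    hp 0 2 3 5 6 4 (by constructor <;> decide) x y
  have n5 : B 0 3 5 → B 1 2 3 → False := fun x y =>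
    hp 0 5 3 1 2 6 (by constructor <;> decide) (s2 _ _ _ x) (r2 _ _ _ y)
  have n6 : B 0 3 5 → B 1 5 6 → False := fun x y =>
    hp 0 3 5 1 6 4 (by constructor <;> decide) x (s1 _ _ _ y)
  have n7 : B 0 3 5 → B 2 4 5 → False := fun x y =>
    hp 0 3 5 2 4 6 (by constructor <;> decide) x (r2 _ _ _ y)
  have n8 : B 1 2 3 → B 1 5 6 → False := fun x y =>
    hp 2 3 1 5 6 4 (by constructor <;> decide) (r1 _ _ _ x) y
  have n9 : B 1 2 3 → B 2 4 5 → False := fun x y =>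
    hp 1 3 2 4 5 6 (by constructor <;> decide) (s2 _ _ _ x) y
  have n10 : B 1 2 5 → B 2 3 4 → False := fun x y =>
    hp 1 5 2 3 4 6 (by constructor <;> decide) (s2 _ _ _ x) y
  have n11 : B 1 2 6 → B 3 5 6 → False := fun x y =>
    hp 1 2 6 3 5 4 (by constructor <;> decide) x (r2 _ _ _ y)
  have n12 : B 1 4 6 → B 2 3 4 → False := fun x y =>
    hp 1 6 4 2 3 5 (by constructor <;> decide) (s2 _ _ _ x) (r2 _ _ _ y)
  have k : ¬ B 0 3 5 := by
    intro h
    rcases c3 with x | x | x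
    · exact n1 x h
    · exact n5 h x
    · rcases c4 with y | y | y
      · exact n4 y x
      · exact n7 h y
      · exact n6 h y
  rcases c1 with h | h | h
  · exact k h
  · rcases c2 with x | x | x
    · exact k x
    · exact n10 x h
    · exact n12 x h
  · rcases c3 with x | x | x
    · exact n2 x h
    · rcases c4 with y | y | y
      · exact n3 y h
      · exact n9 x y
      · exact n8 x y
    · exact n11 h x

/-- a blue alternating path -/
def HasPath {V : Type*} [DecidableEq V] (col : Finset V → Bool) (A : Set V) (B : Finset V)
    (x y : V) (t : ℕ) : Prop :=
  ∃ q : ℕ → V, (∀ i j, i ≤ 6 * t → j ≤ 6 * t → q i = q j → i = j) ∧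
    (∀ j < 2 * t, col (pathEdge q j) = false) ∧
    (∀ i ≤ 6 * t, 6 ∣ i → q i ∈ B) ∧ (∀ i ≤ 6 * t, ¬ 6 ∣ i → q i ∈ A) ∧
    q 0 = x ∧ q (6 * t) = y ∧ B.card = t + 1

lemma HasPath.mem_left {V : Type*} [DecidableEq V] {col : Finset V → Bool} {A : Set V}
    {B : Finset V} {x y : V} {t : ℕ} (h : HasPath col A B x y t) : x ∈ B := by
  obtain ⟨q, -, -, hB, -, h0, -, -⟩ := h
  rw [← h0]; exact hB 0 (by omega) (by omega)

lemma HasPath.card {V : Type*} [DecidableEq V] {col : Finset V → Bool} {A : Set V}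
    {B : Finset V} {x y : V} {t : ℕ} (h : HasPath col A B x y t) : B.card = t + 1 := by
  obtain ⟨q, -, -, hB, -, h0, -, h⟩ := h
  exact h

lemma HasPath.symm {V : Type*} [DecidableEq V] {col : Finset V → Bool} {A : Set V}
    {B : Finset V} {x y : V} {t : ℕ} (h : HasPath col A B x y t) : HasPath col A B y x t := by
  obtain ⟨q, hi, hc, hB, hA, h0, h1, hcard⟩ := h
  refine ⟨fun j => q (6 * t - j), ?_, ?_, ?_, ?_, by simpa using h1, by simpa using h0, hcard⟩
  · intro i j hi' hj' he
    have := hi _ _ (by omega) (by omega) he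
    omega
  · intro j hj
    rw [← hc (2 * t - 1 - j) (by omega), pathEdge_eq, pathEdge_eq]
    congr 1
    rw [show 6 * t - 3 * j = 3 * (2 * t - 1 - j) + 3 by omega,
      show 6 * t - (3 * j + 1) = 3 * (2 * t - 1 - j) + 2 by omega,
      show 6 * t - (3 * j + 2) = 3 * (2 * t - 1 - j) + 1 by omega,
      show 6 * t - (3 * j + 3) = 3 * (2 * t - 1 - j) by omega]
    ext v; simp only [Finset.mem_insert, Finset.mem_singleton]; tauto
  · intro i hi' hd; exact hB _ (by omega) (by omega)
  · intro i hi' hd; exact hA _ (by omega) (by omega)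

lemma HasPath.mem_right {V : Type*} [DecidableEq V] {col : Finset V → Bool} {A : Set V}
    {B : Finset V} {x y : V} {t : ℕ} (h : HasPath col A B x y t) : y ∈ B := h.symm.mem_left

lemma HasPath.ne {V : Type*} [DecidableEq V] {col : Finset V → Bool} {A : Set V}
    {B : Finset V} {x y : V} {t : ℕ} (h : HasPath col A B x y t) (ht : 1 ≤ t) : x ≠ y := by
  obtain ⟨q, hi, hc, hB, hA, h0, h1, hcard⟩ := h
  rintro rfl
  have := hi 0 (6 * t) (by omega) (by omega) (h0.trans h1.symm)
  omega

lemma HasPath.concat {V : Type*} [DecidableEq V] {col : Finset V → Bool} {A A' : Set V}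
    {B B' : Finset V} {x y z : V} {t t' : ℕ} (h : HasPath col A B x y t)
    (h' : HasPath col A' B' y z t') (hA : ∀ v ∈ A, v ∉ A') (hB : ∀ v ∈ B, v ∈ B' → v = y)
    (h1 : ∀ v ∈ A, v ∉ B') (h2 : ∀ v ∈ A', v ∉ B) :
    HasPath col (A ∪ A') (B ∪ B') x z (t + t') := by
  have hy := h.mem_right
  have hy' := h'.mem_left
  obtain ⟨q, qi, qc, qB, qA, q0, q1, qcard⟩ := h
  obtain ⟨p, pi, pc, pB, pA, p0, p1, pcard⟩ := h'
  have hqp : ∀ i j, i ≤ 6 * t → j ≤ 6 * t' → q i = p j → i = 6 * t ∧ j = 0 := by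
    intro i j hi hj he
    by_cases di : 6 ∣ i
    · have hq := qB i hi di
      by_cases dj : 6 ∣ j
      · have hp := pB j hj dj
        have : q i = y := hB _ hq (he ▸ hp)
        exact ⟨qi _ _ hi le_rfl (this.trans q1.symm), pi _ _ hj (by omega) (by rw [← he, this, p0])⟩
      · exact absurd (he ▸ hq) (h2 _ (pA j hj dj))
    · have hq := qA i hi di
      by_cases dj : 6 ∣ j
      · exact absurd (he ▸ pB j hj dj) (h1 _ hq)
      · exact absurd (he ▸ pA j hj dj) (hA _ hq)
  obtain ⟨r, hr1, hr2⟩ : ∃ r : ℕ → V, (∀ i ≤ 6 * t, r i = q i) ∧ ∀ i, r (6 * t + i) = p i := by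
    refine ⟨fun i => if i ≤ 6 * t then q i else p (i - 6 * t), fun i hi => if_pos hi, fun i => ?_⟩
    by_cases hi : i = 0
    · subst hi; simp [q1, p0]
    · simp only []
      rw [if_neg (by omega)]; congr 1; omega
  refine ⟨r, ?_, ?_, ?_, ?_, ?_, ?_, ?_⟩
  · intro i j hi hj he
    by_cases i1 : i ≤ 6 * t <;> by_cases j1 : j ≤ 6 * t
    · rw [hr1 i i1, hr1 j j1] at he
      exact qi _ _ i1 j1 he
    · obtain ⟨k, rfl⟩ : ∃ k, j = 6 * t + k := ⟨j - 6 * t, by omega⟩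
      rw [hr1 i i1, hr2] at he
      have := hqp _ _ i1 (by omega) he
      omega
    · obtain ⟨k, rfl⟩ : ∃ k, i = 6 * t + k := ⟨i - 6 * t, by omega⟩
      rw [hr1 j j1, hr2] at he
      have := hqp _ _ j1 (by omega) he.symm
      omega
    · obtain ⟨k, rfl⟩ : ∃ k, i = 6 * t + k := ⟨i - 6 * t, by omega⟩
      obtain ⟨k', rfl⟩ : ∃ k, j = 6 * t + k := ⟨j - 6 * t, by omega⟩
      rw [hr2, hr2] at he
      have := pi _ _ (by omega) (by omega) he
      omega
  · intro j hj
    by_cases j1 : j < 2 * t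
    · rw [← qc j j1, pathEdge_eq, pathEdge_eq, hr1 _ (by omega), hr1 _ (by omega),
        hr1 _ (by omega), hr1 _ (by omega)]
    · obtain ⟨k, rfl⟩ : ∃ k, j = 2 * t + k := ⟨j - 2 * t, by omega⟩
      rw [← pc k (by omega), pathEdge_eq, pathEdge_eq,
        show 3 * (2 * t + k) = 6 * t + 3 * k by ring, hr2, add_assoc, hr2, add_assoc, hr2,
        add_assoc, hr2]
  · intro i hi hd
    by_cases i1 : i ≤ 6 * t
    · rw [hr1 i i1]; exact Finset.mem_union_left _ (qB i i1 hd)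
    · obtain ⟨k, rfl⟩ : ∃ k, i = 6 * t + k := ⟨i - 6 * t, by omega⟩
      rw [hr2]; exact Finset.mem_union_right _ (pB k (by omega) (by omega))
  · intro i hi hd
    by_cases i1 : i ≤ 6 * t
    · rw [hr1 i i1]; exact Or.inl (qA i i1 hd)
    · obtain ⟨k, rfl⟩ : ∃ k, i = 6 * t + k := ⟨i - 6 * t, by omega⟩
      rw [hr2]; exact Or.inr (pA k (by omega) (by omega))
  · rw [hr1 0 (by omega), q0]
  · rw [mul_add, hr2, p1]
  · have hI : B ∩ B' = {y} := by
      ext v; simp only [Finset.mem_inter, Finset.mem_singleton]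
      constructor
      · rintro ⟨a, b⟩; exact hB v a b
      · rintro rfl; exact ⟨hy, hy'⟩
    have := Finset.card_union_add_card_inter B B'
    rw [hI, Finset.card_singleton] at this
    omega

lemma HasPath.mono {V : Type*} [DecidableEq V] {col : Finset V → Bool} {A A' : Set V}
    {B : Finset V} {x y : V} {t : ℕ} (h : HasPath col A B x y t) (hA : A ⊆ A') :
    HasPath col A' B x y t := by
  obtain ⟨q, hi, hc, hB, hA', h⟩ := h
  exact ⟨q, hi, hc, hB, fun i h1 h2 => hA (hA' i h1 h2), h⟩

lemma config {V : Type*} [DecidableEq V] {col : Finset V → Bool} {x y a b c d e : V}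
    (hn : [x, a, b, c, d, e, y].Nodup) (h1 : col {a, b, c, x} = false)
    (h2 : col {c, d, e, y} = false) : HasPath col {a, b, c, d, e} {x, y} x y 1 := by
  refine ⟨fun i => [x, a, b, c, d, e, y].getD i x, ?_, ?_, ?_, ?_, rfl, rfl, ?_⟩
  · intro i j hi hj he
    simp only [] at he
    rw [List.getD_eq_getElem _ _ (by simp; omega), List.getD_eq_getElem _ _ (by simp; omega)] at he
    exact (List.Nodup.getElem_inj_iff hn).1 he
  · intro j hj
    interval_cases j
    · rw [← h1, pathEdge_eq]
      congr 1
      ext v; simp; tauto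
    · rw [← h2, pathEdge_eq]
      congr 1
  · intro i hi hd
    interval_cases i <;> first | (exfalso; omega) | simp
  · intro i hi hd
    interval_cases i <;> first | (exfalso; omega) | simp
  · rw [Finset.card_pair]
    simp at hn; tauto

def Base {V : Type*} (g : ℕ → V) (k pos : ℕ) (A : Set V) : Prop :=
  pos ≤ 6 * k ∧ 6 * k ≤ pos + 2 ∧ g pos ∉ A ∧ A ⊆ pathVerts g (2 * k)

lemma step {V : Type*} [DecidableEq V] {n : ℕ} {col : Finset V → Bool} {g : ℕ → V}
    (hP : IsLoosePath4 col true g n) {W : Finset V} (hWP : ∀ w ∈ W, w ∉ pathVerts g n)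
    (hmax : MaximalWrt col g n ↑W) {k pos : ℕ} {A : Set V} (hk : 2 * k + 2 ≤ n)
    (hb : Base g k pos A) {T : Finset V} (hT : T ⊆ W) :
    ∃ (S : Set V) (pos' : ℕ) (R1 R2 : Finset V), R1.card ≤ 2 ∧ R2.card ≤ 2 ∧
      Base g (k + 1) pos' (A ∪ S) ∧ (∀ v ∈ A, v ∉ S) ∧
      ∀ x ∈ T, ∀ y ∈ T, x ∉ R1 → y ∉ R2 → x ≠ y → HasPath col S {x, y} x y 1 := by
  obtain ⟨b1, b2, b3, b4⟩ := hb
  obtain ⟨a, b, c, d, e, f, hg6, hB1, hB2⟩ := core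
    (fun a b c => (redSet col T (locP g (2 * k) pos) a b c).card ≤ 2)
    (fun a b c h => by rwa [redSet_swap1]) (fun a b c h => by rwa [redSet_swap2])
    (fun a b c d e h => clause hP hWP hmax hk (by omega) (by omega) hT h)
  have hinj : ∀ i j, i ≤ 3 * n → j ≤ 3 * n → g i = g j → i = j := fun i j hi hj he =>
    hP.1 (Set.mem_Iio.2 (by omega)) (Set.mem_Iio.2 (by omega)) he
  have pinj : ∀ i j, i < 7 → j < 7 → i ≠ j → locP g (2 * k) pos i ≠ locP g (2 * k) pos j := by
    intro i j hi hj hne he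
    unfold locP at he
    split_ifs at he with q1 q2 q2
    · omega
    · have := hinj _ _ (by omega) (by omega) he; omega
    · have := hinj _ _ (by omega) (by omega) he; omega
    · have := hinj _ _ (by omega) (by omega) he; omega
  have pv : ∀ i < 7, locP g (2 * k) pos i ∈ pathVerts g (2 * k + 2) := by
    intro i hi
    unfold locP
    split_ifs
    · exact mem_pathVerts.2 ⟨pos, by omega, rfl⟩
    · exact mem_pathVerts.2 ⟨3 * (2 * k) + i, by omega, rfl⟩
  have gA : ∀ j, 6 * k < j → j ≤ 3 * n → g j ∉ A := by
    intro j hj hj' hA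
    obtain ⟨i, hi, he⟩ := mem_pathVerts.1 (b4 hA)
    have := hinj _ _ (by omega) (by omega) he
    omega
  have pA : ∀ i < 7, locP g (2 * k) pos i ∉ A := by
    intro i hi
    unfold locP
    split_ifs
    · exact b3
    · exact gA _ (by omega) (by omega)
  have pW : ∀ i < 7, ∀ w ∈ W, locP g (2 * k) pos i ≠ w := by
    intro i hi w hw he
    apply hWP w hw
    rw [← he]
    obtain ⟨j, hj, h⟩ := mem_pathVerts.1 (pv i hi)
    exact mem_pathVerts.2 ⟨j, by omega, h⟩
  obtain ⟨⟨la, lb, lc, ld, le, lf⟩, hf, ⟨ab, ac, ad, ae, af⟩, ⟨bc, bd, be, bf⟩, ⟨cd, ce, cf⟩,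
    de, df, ef⟩ := hg6
  have hpf : g (3 * (2 * k) + f) = locP g (2 * k) pos f := by
    unfold locP; rw [if_neg (by omega)]
  generalize locP g (2 * k) pos = p at *
  refine ⟨{p a, p b, p c, p d, p e}, 3 * (2 * k) + f, redSet col T p a b c, redSet col T p c d e,
    hB1, hB2, ⟨by omega, by omega, ?_, ?_⟩, ?_, ?_⟩
  · rintro (h | h)
    · exact gA _ (by omega) (by omega) h
    · rw [hpf] at h
      simp only [Set.mem_insert_iff, Set.mem_singleton_iff] at h
      rcases h with h | h | h | h | h
      · exact pinj _ _ la lf af h.symm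
      · exact pinj _ _ lb lf bf h.symm
      · exact pinj _ _ lc lf cf h.symm
      · exact pinj _ _ ld lf df h.symm
      · exact pinj _ _ le lf ef h.symm
  · rintro v (h | h)
    · obtain ⟨j, hj, h⟩ := mem_pathVerts.1 (b4 h)
      exact mem_pathVerts.2 ⟨j, by omega, h⟩
    · simp only [Set.mem_insert_iff, Set.mem_singleton_iff] at h
      rw [show 2 * (k + 1) = 2 * k + 2 by ring]
      rcases h with rfl | rfl | rfl | rfl | rfl
      all_goals apply pv; assumption
  · intro v hv h
    simp only [Set.mem_insert_iff, Set.mem_singleton_iff] at h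
    rcases h with rfl | rfl | rfl | rfl | rfl
    all_goals revert hv; apply pA; assumption
  · intro x hx y hy hx1 hy2 hxy
    simp only [redSet, Finset.mem_filter, not_and, Bool.not_eq_true] at hx1 hy2
    apply config _ (hx1 hx) (hy2 hy)
    have wx := fun i hi => pW i hi x (hT hx)
    have wy := fun i hi => pW i hi y (hT hy)
    simp only [List.nodup_cons, List.mem_cons, List.not_mem_nil, or_false, not_or, not_false_eq_true,
      List.nodup_nil, and_true]
    refine ⟨⟨(wx a la).symm, (wx b lb).symm, (wx c lc).symm, (wx d ld).symm, (wx e le).symm, hxy⟩,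
      ⟨pinj _ _ la lb ab, pinj _ _ la lc ac, pinj _ _ la ld ad, pinj _ _ la le ae, wy a la⟩,
      ⟨pinj _ _ lb lc bc, pinj _ _ lb ld bd, pinj _ _ lb le be, wy b lb⟩,
      ⟨pinj _ _ lc ld cd, pinj _ _ lc le ce, wy c lc⟩,
      ⟨pinj _ _ ld le de, wy d ld⟩, wy e le⟩

lemma HasPath.ext1 {V : Type*} [DecidableEq V] {col : Finset V → Bool} {A S : Set V}
    {B W : Finset V} {x y z : V} {t : ℕ} (h : HasPath col A B x y t)
    (h' : HasPath col S {y, z} y z 1) (hBW : B ⊆ W) (hz : z ∈ W) (hzB : z ∉ B)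
    (hAS : ∀ v ∈ A, v ∉ S) (hAW : ∀ v ∈ A, v ∉ W) (hSW : ∀ v ∈ S, v ∉ W) :
    HasPath col (A ∪ S) (insert z B) x z (t + 1) := by
  have hy : y ∈ B := h.mem_right
  have := h.concat h' hAS ?_ ?_ ?_
  · convert this using 1
    ext v; simp only [Finset.mem_insert, Finset.mem_union, Finset.mem_singleton]
    constructor
    · tauto
    · rintro (h | rfl | h)
      · exact Or.inr h
      · exact Or.inr hy
      · exact Or.inl h
  · intro v hv hv'
    simp only [Finset.mem_insert, Finset.mem_singleton] at hv'
    rcases hv' with h | rfl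
    · exact h
    · exact absurd hv hzB
  · intro v hv hv'
    simp only [Finset.mem_insert, Finset.mem_singleton] at hv'
    rcases hv' with rfl | rfl
    · exact hAW _ hv (hBW hy)
    · exact hAW _ hv hz
  · intro v hv hv'
    exact hSW v hv (hBW hv')

def StOne {V : Type*} [DecidableEq V] (col : Finset V → Bool) (W : Finset V) (k : ℕ) (A : Set V) :
    Prop :=
  ∃ B x y, B ⊆ W ∧ HasPath col A B x y k ∧ B.card + 1 ≤ W.card

def StTwo {V : Type*} [DecidableEq V] (col : Finset V → Bool) (W : Finset V) (k : ℕ) (A : Set V) :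
    Prop :=
  ∃ A1 A2 B1 B2 x1 y1 x2 y2 t1 t2, A1 ⊆ A ∧ A2 ⊆ A ∧ (∀ v ∈ A1, v ∉ A2) ∧ B1 ⊆ W ∧ B2 ⊆ W ∧
    (∀ v ∈ B1, v ∉ B2) ∧ 1 ≤ t1 ∧ 1 ≤ t2 ∧ t1 + t2 = k ∧
    HasPath col A1 B1 x1 y1 t1 ∧ HasPath col A2 B2 x2 y2 t2

/-- state one step -/
lemma stepOne {V : Type*} [DecidableEq V] {n : ℕ} {col : Finset V → Bool} {g : ℕ → V}
    (hP : IsLoosePath4 col true g n) {W : Finset V} (hWP : ∀ w ∈ W, w ∉ pathVerts g n)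
    (hmax : MaximalWrt col g n ↑W) {k pos : ℕ} {A : Set V} (hk1 : 1 ≤ k) (hk : 2 * k + 2 ≤ n)
    (hb : Base g k pos A) {B : Finset V} {x y : V} (hBW : B ⊆ W) (hp : HasPath col A B x y k)
    (hF : 3 ≤ (W \ B).card) :
    ∃ pos' A', Base g (k + 1) pos' A' ∧ (StOne col W (k + 1) A' ∨ StTwo col W (k + 1) A') := by
  have hx := hp.mem_left
  have hy := hp.mem_right
  have hxy := hp.ne hk1
  have hTW : insert x (insert y (W \ B)) ⊆ W := by
    intro v hv
    simp only [Finset.mem_insert, Finset.mem_sdiff] at hv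
    rcases hv with rfl | rfl | h
    · exact hBW hx
    · exact hBW hy
    · exact h.1
  obtain ⟨S, pos', R1, R2, r1, r2, hb', hAS, hc⟩ := step hP hWP hmax hk hb hTW
  have hAW : ∀ v ∈ A ∪ S, v ∉ W := by
    intro v hv hw
    apply hWP v hw
    obtain ⟨j, hj, he⟩ := mem_pathVerts.1 (hb'.2.2.2 hv)
    exact mem_pathVerts.2 ⟨j, by omega, he⟩
  refine ⟨pos', A ∪ S, hb', ?_⟩
  obtain ⟨z, hz, hzR⟩ := Finset.exists_mem_notMem_of_card_lt_card (s := R1) (t := W \ B) (by omega)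
  have hzB := Finset.mem_sdiff.1 hz
  obtain ⟨v, hv, hvR⟩ := Finset.exists_mem_notMem_of_card_lt_card (s := insert z R2)
    (t := insert x (insert y (W \ B))) (by
      have h1 := Finset.card_insert_le z R2
      have n1 : x ∉ insert y (W \ B) := by simp [hx, hxy]
      have n2 : y ∉ W \ B := by simp [hy]
      rw [Finset.card_insert_of_notMem n1, Finset.card_insert_of_notMem n2]
      omega)
  have hvz : v ≠ z ∧ v ∉ R2 := by simpa using hvR
  have hpath := hc z (by simp [hzB]) v hv hzR hvz.2 hvz.1.symm
  have hAW1 : ∀ v ∈ A, v ∉ W := fun v hv => hAW v (Or.inl hv)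
  have hAW2 : ∀ v ∈ S, v ∉ W := fun v hv => hAW v (Or.inr hv)
  have hcard : (insert z B).card + 1 ≤ W.card := by
    rw [Finset.card_insert_of_notMem hzB.2]
    have := Finset.card_sdiff_add_card_eq_card hBW
    omega
  have hsub : insert z B ⊆ W := Finset.insert_subset hzB.1 hBW
  rw [Finset.pair_comm] at hpath
  simp only [Finset.mem_insert] at hv
  rcases hv with rfl | rfl | hv
  · exact Or.inl ⟨_, _, _, hsub, hp.symm.ext1 hpath.symm hBW hzB.1 hzB.2 hAS hAW1 hAW2, hcard⟩
  · exact Or.inl ⟨_, _, _, hsub, hp.ext1 hpath.symm hBW hzB.1 hzB.2 hAS hAW1 hAW2, hcard⟩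
  · have hvB := Finset.mem_sdiff.1 hv
    refine Or.inr ⟨A, S, B, {v, z}, x, y, _, _, k, 1, Set.subset_union_left, Set.subset_union_right,
      hAS, hBW, ?_, ?_, hk1, le_rfl, rfl, hp, hpath⟩
    · intro w hw
      simp only [Finset.mem_insert, Finset.mem_singleton] at hw
      rcases hw with rfl | rfl
      · exact hvB.1
      · exact hzB.1
    · intro w hw hw'
      simp only [Finset.mem_insert, Finset.mem_singleton] at hw'
      rcases hw' with rfl | rfl
      · exact hvB.2 hw
      · exact hzB.2 hw

/-- merging -/
lemma HasPath.merge {V : Type*} [DecidableEq V] {col : Finset V → Bool} {A1 A2 S : Set V}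
    {B1 B2 W : Finset V} {x y z w : V} {t1 t2 : ℕ} (h1 : HasPath col A1 B1 x y t1)
    (h : HasPath col S {y, z} y z 1) (h2 : HasPath col A2 B2 z w t2)
    (hB1 : B1 ⊆ W) (hB2 : B2 ⊆ W) (hB : ∀ v ∈ B1, v ∉ B2) (hA : ∀ v ∈ A1, v ∉ A2)
    (hAS1 : ∀ v ∈ A1, v ∉ S) (hAS2 : ∀ v ∈ A2, v ∉ S)
    (hAW1 : ∀ v ∈ A1, v ∉ W) (hAW2 : ∀ v ∈ A2, v ∉ W) (hSW : ∀ v ∈ S, v ∉ W) :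
    HasPath col (A1 ∪ S ∪ A2) (B1 ∪ B2) x w (t1 + 1 + t2) := by
  have hz := h2.mem_left
  have := (h1.ext1 h hB1 (hB2 hz) (fun h => hB z h hz) hAS1 hAW1 hSW).concat h2 ?_ ?_ ?_ ?_
  · convert this using 1
    ext v; simp only [Finset.mem_insert, Finset.mem_union]
    constructor
    · tauto
    · rintro ((rfl | h) | h)
      · exact Or.inr hz
      · exact Or.inl h
      · exact Or.inr h
  · rintro v (hv | hv) hv'
    · exact hA v hv hv'
    · exact hAS2 v hv' hv
  · intro v hv hv'
    rcases Finset.mem_insert.1 hv with h | h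
    · exact h
    · exact absurd hv' (hB v h)
  · rintro v (hv | hv) hv'
    · exact hAW1 v hv (hB2 hv')
    · exact hSW v hv (hB2 hv')
  · intro v hv hv'
    rcases Finset.mem_insert.1 hv' with rfl | h
    · exact hAW2 _ hv (hB2 hz)
    · exact hAW2 _ hv (hB1 h)

/-- choosing an admissible pair -/
lemma choose_pair {V : Type*} [DecidableEq V] {x y x' y' z : V} {R1 R2 : Finset V}
    (hn : [x, y, x', y', z].Nodup) (h1 : R1.card ≤ 2) (h2 : R2.card ≤ 2) :
    ∃ u v, u ∉ R1 ∧ v ∉ R2 ∧ u ≠ v ∧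
      ((u = z ∧ (v = x ∨ v = y ∨ v = x' ∨ v = y')) ∨ (v = z ∧ (u = x ∨ u = y ∨ u = x' ∨ u = y')) ∨
       ((u = x ∨ u = y) ∧ (v = x' ∨ v = y'))) := by
  simp only [List.nodup_cons, List.mem_cons, List.not_mem_nil, or_false, not_or,
    not_false_eq_true, List.nodup_nil, and_true] at hn
  obtain ⟨⟨n1, n2, n3, n4⟩, ⟨n5, n6, n7⟩, ⟨n8, n9⟩, n10⟩ := hn
  have three : ∀ (R : Finset V), R.card ≤ 2 → ∀ a b c : V, a ≠ b → a ≠ c → b ≠ c →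
      a ∈ R → b ∈ R → c ∈ R → False := by
    intro R hR a b c ab ac bc ha hb hc
    have h3 : ({a, b, c} : Finset V).card = 3 := Finset.card_eq_three.2 ⟨a, b, c, ab, ac, bc, rfl⟩
    have : ({a, b, c} : Finset V) ⊆ R := by
      intro v hv
      simp only [Finset.mem_insert, Finset.mem_singleton] at hv
      rcases hv with rfl | rfl | rfl <;> assumption
    have := Finset.card_le_card this
    omega
  by_cases hz1 : z ∈ R1
  · by_cases hz2 : z ∈ R2
    · have hu : ∃ u, u ∉ R1 ∧ (u = x ∨ u = y) := by
        by_contra! hcon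
        exact three R1 h1 x y z n1 n4 n7 (by_contra fun h => (hcon x h).1 rfl)
          (by_contra fun h => (hcon y h).2 rfl) hz1
      have hv : ∃ v, v ∉ R2 ∧ (v = x' ∨ v = y') := by
        by_contra! hcon
        exact three R2 h2 x' y' z n8 n9 n10 (by_contra fun h => (hcon x' h).1 rfl)
          (by_contra fun h => (hcon y' h).2 rfl) hz2
      obtain ⟨u, hu, hu'⟩ := hu
      obtain ⟨v, hv, hv'⟩ := hv
      refine ⟨u, v, hu, hv, ?_, Or.inr (Or.inr ⟨hu', hv'⟩)⟩
      rcases hu' with rfl | rfl <;> rcases hv' with rfl | rfl <;> assumption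
    · have hu : ∃ u, u ∉ R1 ∧ (u = x ∨ u = y ∨ u = x') := by
        by_contra! hcon
        exact three R1 h1 x y x' n1 n2 n5 (by_contra fun h => (hcon x h).1 rfl)
          (by_contra fun h => (hcon y h).2.1 rfl) (by_contra fun h => (hcon x' h).2.2 rfl)
      obtain ⟨u, hu, hu'⟩ := hu
      refine ⟨u, z, hu, hz2, ?_, Or.inr (Or.inl ⟨rfl, by tauto⟩)⟩
      rcases hu' with rfl | rfl | rfl <;> assumption
  · have hv : ∃ u, u ∉ R2 ∧ (u = x ∨ u = y ∨ u = x') := by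
      by_contra! hcon
      exact three R2 h2 x y x' n1 n2 n5 (by_contra fun h => (hcon x h).1 rfl)
        (by_contra fun h => (hcon y h).2.1 rfl) (by_contra fun h => (hcon x' h).2.2 rfl)
    obtain ⟨v, hv, hv'⟩ := hv
    refine ⟨z, v, hz1, hv, ?_, Or.inl ⟨rfl, by tauto⟩⟩
    rcases hv' with rfl | rfl | rfl <;> exact Ne.symm ‹_›

lemma extTwo {V : Type*} [DecidableEq V] {col : Finset V → Bool} {W : Finset V} {A A1 A2 S : Set V}
    {B1 B2 : Finset V} {x1 y1 x2 y2 z : V} {t1 t2 : ℕ} (hA1 : A1 ⊆ A) (hA2 : A2 ⊆ A)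
    (hA : ∀ v ∈ A1, v ∉ A2) (hB1 : B1 ⊆ W) (hB2 : B2 ⊆ W) (hB : ∀ v ∈ B1, v ∉ B2)
    (h1 : 1 ≤ t1) (h2 : 1 ≤ t2) (p1 : HasPath col A1 B1 x1 y1 t1) (p2 : HasPath col A2 B2 x2 y2 t2)
    (hAS : ∀ v ∈ A, v ∉ S) (hAW : ∀ v ∈ A ∪ S, v ∉ W) (hz : z ∈ W) (hz1 : z ∉ B1) (hz2 : z ∉ B2)
    (e : V) (he : e = x1 ∨ e = y1) (hc : HasPath col S {e, z} e z 1) :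
    StTwo col W (t1 + t2 + 1) (A ∪ S) := by
  have hAW1 : ∀ v ∈ A1, v ∉ W := fun v hv => hAW v (Or.inl (hA1 hv))
  have hSW : ∀ v ∈ S, v ∉ W := fun v hv => hAW v (Or.inr hv)
  have hAS1 : ∀ v ∈ A1, v ∉ S := fun v hv => hAS v (hA1 hv)
  obtain ⟨u, hu⟩ : ∃ u, HasPath col (A1 ∪ S) (insert z B1) u z (t1 + 1) := by
    rcases he with rfl | rfl
    · exact ⟨_, p1.symm.ext1 hc hB1 hz hz1 hAS1 hAW1 hSW⟩
    · exact ⟨_, p1.ext1 hc hB1 hz hz1 hAS1 hAW1 hSW⟩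
  refine ⟨A1 ∪ S, A2, insert z B1, B2, u, z, x2, y2, t1 + 1, t2, ?_, ?_, ?_, ?_, hB2, ?_, by omega,
    h2, by omega, hu, p2⟩
  · exact Set.union_subset_union_left _ hA1
  · exact hA2.trans Set.subset_union_left
  · rintro v (hv | hv) hv'
    · exact hA v hv hv'
    · exact hAS v (hA2 hv') hv
  · exact Finset.insert_subset hz hB1
  · intro v hv hv'
    rcases Finset.mem_insert.1 hv with rfl | h
    · exact hz2 hv'
    · exact hB v h hv'

lemma stepTwo {V : Type*} [DecidableEq V] {n : ℕ} {col : Finset V → Bool} {g : ℕ → V}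
    (hP : IsLoosePath4 col true g n) {W : Finset V} (hWP : ∀ w ∈ W, w ∉ pathVerts g n)
    (hmax : MaximalWrt col g n ↑W) {k pos : ℕ} {A A1 A2 : Set V} (hk : 2 * k + 2 ≤ n)
    (hb : Base g k pos A) {B1 B2 : Finset V} {x1 y1 x2 y2 : V} {t1 t2 : ℕ}
    (hA1 : A1 ⊆ A) (hA2 : A2 ⊆ A)
    (hA : ∀ v ∈ A1, v ∉ A2) (hB1 : B1 ⊆ W) (hB2 : B2 ⊆ W) (hB : ∀ v ∈ B1, v ∉ B2)
    (h1 : 1 ≤ t1) (h2 : 1 ≤ t2) (ht : t1 + t2 = k)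
    (p1 : HasPath col A1 B1 x1 y1 t1) (p2 : HasPath col A2 B2 x2 y2 t2)
    (hF : 1 ≤ (W \ (B1 ∪ B2)).card) :
    ∃ pos' A', Base g (k + 1) pos' A' ∧ (StOne col W (k + 1) A' ∨ StTwo col W (k + 1) A') := by
  obtain ⟨z, hz⟩ := Finset.card_pos.1 hF
  obtain ⟨hzW, hz'⟩ := Finset.mem_sdiff.1 hz
  obtain ⟨hz1, hz2⟩ : z ∉ B1 ∧ z ∉ B2 := by simpa using hz'
  have mx1 := p1.mem_left
  have my1 := p1.mem_right
  have mx2 := p2.mem_left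
  have my2 := p2.mem_right
  have hTW : ({x1, y1, x2, y2, z} : Finset V) ⊆ W := by
    intro v hv
    simp only [Finset.mem_insert, Finset.mem_singleton] at hv
    rcases hv with rfl | rfl | rfl | rfl | rfl
    · exact hB1 mx1
    · exact hB1 my1
    · exact hB2 mx2
    · exact hB2 my2
    · exact hzW
  obtain ⟨S, pos', R1, R2, r1, r2, hb', hAS, hc⟩ := step hP hWP hmax hk hb hTW
  have hAW : ∀ v ∈ A ∪ S, v ∉ W := by
    intro v hv hw
    apply hWP v hw
    obtain ⟨j, hj, he⟩ := mem_pathVerts.1 (hb'.2.2.2 hv)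
    exact mem_pathVerts.2 ⟨j, by omega, he⟩
  refine ⟨pos', A ∪ S, hb', ?_⟩
  have hnd : [x1, y1, x2, y2, z].Nodup := by
    have ne : ∀ a ∈ B1, ∀ b ∈ B2, a ≠ b := by
      rintro a ha b hb rfl; exact hB a ha hb
    have nz1 : ∀ a ∈ B1, a ≠ z := by
      rintro a ha rfl; exact hz1 ha
    have nz2 : ∀ a ∈ B2, a ≠ z := by
      rintro a ha rfl; exact hz2 ha
    simp only [List.nodup_cons, List.mem_cons, List.not_mem_nil, or_false, not_or,
      not_false_eq_true, List.nodup_nil, and_true]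
    exact ⟨⟨p1.ne h1, ne _ mx1 _ mx2, ne _ mx1 _ my2, nz1 _ mx1⟩,
      ⟨ne _ my1 _ mx2, ne _ my1 _ my2, nz1 _ my1⟩, ⟨p2.ne h2, nz2 _ mx2⟩, nz2 _ my2⟩
  have E1 := extTwo (z := z) hA1 hA2 hA hB1 hB2 hB h1 h2 p1 p2 hAS hAW hzW hz1 hz2
  have E2 := extTwo (z := z) hA2 hA1 (fun v h h' => hA v h' h) hB2 hB1 (fun v h h' => hB v h' h)
    h2 h1 p2 p1 hAS hAW hzW hz2 hz1
  rw [ht] at E1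
  rw [add_comm t2 t1, ht] at E2
  have E : ∀ e, (e = x1 ∨ e = y1 ∨ e = x2 ∨ e = y2) → HasPath col S {e, z} e z 1 →
      StTwo col W (k + 1) (A ∪ S) := by
    rintro e (h | h | h | h) hq
    · exact E1 e (Or.inl h) hq
    · exact E1 e (Or.inr h) hq
    · exact E2 e (Or.inl h) hq
    · exact E2 e (Or.inr h) hq
  obtain ⟨u, v, hu, hv, huv, hcase⟩ := choose_pair hnd r1 r2
  have hq := hc u (by simp only [Finset.mem_insert, Finset.mem_singleton]; tauto) v
    (by simp only [Finset.mem_insert, Finset.mem_singleton]; tauto) hu hv huv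
  rcases hcase with ⟨rfl, h⟩ | ⟨rfl, h⟩ | ⟨h, h'⟩
  · right
    rw [Finset.pair_comm] at hq
    exact E v h hq.symm
  · right
    exact E u h hq
  · left
    obtain ⟨x1', q1⟩ : ∃ x, HasPath col A1 B1 x u t1 := by
      rcases h with rfl | rfl
      · exact ⟨_, p1.symm⟩
      · exact ⟨_, p1⟩
    obtain ⟨y2', q2⟩ : ∃ y, HasPath col A2 B2 v y t2 := by
      rcases h' with rfl | rfl
      · exact ⟨_, p2⟩
      · exact ⟨_, p2.symm⟩
    have hm := HasPath.merge q1 hq q2 hB1 hB2 hB hA (fun v hv => hAS v (hA1 hv))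
      (fun v hv => hAS v (hA2 hv)) (fun v hv => hAW v (Or.inl (hA1 hv)))
      (fun v hv => hAW v (Or.inl (hA2 hv))) (fun v hv => hAW v (Or.inr hv))
    have hBW := Finset.union_subset hB1 hB2
    refine ⟨B1 ∪ B2, x1', y2', hBW, ?_, ?_⟩
    · rw [show k + 1 = t1 + 1 + t2 by omega]
      refine hm.mono ?_
      rintro w ((hw | hw) | hw)
      · exact Or.inl (hA1 hw)
      · exact Or.inr hw
      · exact Or.inl (hA2 hw)
    · have := Finset.card_sdiff_add_card_eq_card hBW
      omega

lemma start {V : Type*} [DecidableEq V] {n : ℕ} {col : Finset V → Bool} {g : ℕ → V} (hn : 2 ≤ n)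
    (hP : IsLoosePath4 col true g n) {W : Finset V} (hWP : ∀ w ∈ W, w ∉ pathVerts g n)
    (hmax : MaximalWrt col g n ↑W) (hW : 4 ≤ W.card) :
    ∃ pos' A', Base g 1 pos' A' ∧ StOne col W 1 A' := by
  obtain ⟨S, pos', R1, R2, r1, r2, hb', hAS, hc⟩ := step (k := 0) (pos := 0) (A := ∅) hP hWP hmax
    (by omega) ⟨by omega, by omega, by simp, by simp⟩ (Finset.Subset.refl W)
  refine ⟨pos', _, hb', ?_⟩
  obtain ⟨z, hz, hzR⟩ := Finset.exists_mem_notMem_of_card_lt_card (s := R1) (t := W) (by omega)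
  obtain ⟨v, hv, hvR⟩ := Finset.exists_mem_notMem_of_card_lt_card (s := insert z R2)
    (t := W) (by
      have h1 := Finset.card_insert_le z R2
      omega)
  have hvz : v ≠ z ∧ v ∉ R2 := by simpa using hvR
  refine ⟨{z, v}, z, v, ?_, (hc z hz v hv hzR hvz.2 hvz.1.symm).mono Set.subset_union_right, ?_⟩
  · intro w hw
    simp only [Finset.mem_insert, Finset.mem_singleton] at hw
    rcases hw with rfl | rfl <;> assumption
  · have := Finset.card_le_two (a := z) (b := v)
    omega

lemma reach {V : Type*} [DecidableEq V] {n : ℕ} {col : Finset V → Bool} {g : ℕ → V}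
    (hP : IsLoosePath4 col true g n) {W : Finset V} (hWP : ∀ w ∈ W, w ∉ pathVerts g n)
    (hmax : MaximalWrt col g n ↑W) (N : ℕ) : ∀ k pos A, n ≤ 2 * k + N → 1 ≤ k → 2 * k ≤ n →
    Base g k pos A → (StOne col W k A ∨ StTwo col W k A) →
    ∃ k pos A, 1 ≤ k ∧ 2 * k ≤ n ∧ Base g k pos A ∧
      ((∃ B x y, B ⊆ W ∧ HasPath col A B x y k ∧ 1 ≤ (W \ B).card ∧
        ((W \ B).card ≤ 2 ∨ n ≤ 2 * k + 1)) ∨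
       (∃ A1 A2 B1 B2 x1 y1 x2 y2 t1 t2, A1 ⊆ A ∧ A2 ⊆ A ∧ (∀ v ∈ A1, v ∉ A2) ∧ B1 ⊆ W ∧ B2 ⊆ W ∧
        (∀ v ∈ B1, v ∉ B2) ∧ 1 ≤ t1 ∧ 1 ≤ t2 ∧ t1 + t2 = k ∧
        HasPath col A1 B1 x1 y1 t1 ∧ HasPath col A2 B2 x2 y2 t2 ∧
        ((W \ (B1 ∪ B2)).card = 0 ∨ n ≤ 2 * k + 1))) := by
  induction N with
  | zero =>
    intro k pos A hN hk hkn hb hst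
    refine ⟨k, pos, A, hk, hkn, hb, ?_⟩
    rcases hst with ⟨B, x, y, hB, hp, hc⟩ | ⟨A1, A2, B1, B2, x1, y1, x2, y2, t1, t2, h1, h2, h3, h4, h5,
      h6, h7, h8, h9, h10, h11⟩
    · have := Finset.card_sdiff_add_card_eq_card hB
      exact Or.inl ⟨B, x, y, hB, hp, by omega, Or.inr (by omega)⟩
    · exact Or.inr ⟨A1, A2, B1, B2, x1, y1, x2, y2, t1, t2, h1, h2, h3, h4, h5,
        h6, h7, h8, h9, h10, h11, Or.inr (by omega)⟩
  | succ N ih =>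
    intro k pos A hN hk hkn hb hst
    rcases hst with ⟨B, x, y, hB, hp, hc⟩ | ⟨A1, A2, B1, B2, x1, y1, x2, y2, t1, t2, h1, h2, h3, h4, h5,
      h6, h7, h8, h9, h10, h11⟩
    · have := Finset.card_sdiff_add_card_eq_card hB
      by_cases hs : (W \ B).card ≤ 2 ∨ n ≤ 2 * k + 1
      · exact ⟨k, pos, A, hk, hkn, hb, Or.inl ⟨B, x, y, hB, hp, by omega, hs⟩⟩
      · push Not at hs
        obtain ⟨pos', A', hb', hst'⟩ := stepOne hP hWP hmax hk (by omega) hb hB hp (by omega)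
        exact ih (k + 1) pos' A' (by omega) (by omega) (by omega) hb' hst'
    · by_cases hs : (W \ (B1 ∪ B2)).card = 0 ∨ n ≤ 2 * k + 1
      · exact ⟨k, pos, A, hk, hkn, hb, Or.inr ⟨A1, A2, B1, B2, x1, y1, x2, y2, t1, t2, h1, h2, h3, h4,
          h5, h6, h7, h8, h9, h10, h11, hs⟩⟩
      · push Not at hs
        obtain ⟨pos', A', hb', hst'⟩ := stepTwo hP hWP hmax (by omega) hb h1 h2 h3 h4 h5 h6 h7 h8 h9
          h10 h11 (by omega)
        exact ih (k + 1) pos' A' (by omega) (by omega) (by omega) hb' hst'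

lemma HasPath.unpack {V : Type*} [DecidableEq V] {col : Finset V → Bool} {g : ℕ → V}
    {A : Set V} {B W' : Finset V} {x y : V} {t m : ℕ} (h : HasPath col A B x y t)
    (hBW : B ⊆ W') (hAW : ∀ v ∈ A, v ∉ W') (hAm : A ⊆ pathVerts g m) :
    ∃ q : ℕ → V, IsLoosePath4 col false q (2 * t) ∧
      (∀ v ∈ pathVerts q (2 * t), v ∈ A ∨ v ∈ B) ∧
      (∀ j < 2 * t, (pathEdge q j ∩ W') ⊆ {q (3 * j), q (3 * j + 3)} ∧
        (pathEdge q j ∩ W').card = 1 ∧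
        ∀ v ∈ pathEdge q j, v ∉ W' → v ∈ pathVerts g m) := by
  obtain ⟨q, hi, hc, hB, hA, -, -, -⟩ := h
  have key : ∀ i ≤ 6 * t, (q i ∈ W' ↔ 6 ∣ i) := by
    intro i h
    constructor
    · intro hw
      by_contra hd
      exact hAW _ (hA i h hd) hw
    · intro hd; exact hBW (hB i h hd)
  refine ⟨q, ⟨?_, hc⟩, ?_, ?_⟩
  · intro i h j h' he
    have a := Set.mem_Iio.1 h
    have b := Set.mem_Iio.1 h'
    exact hi i j (by omega) (by omega) he
  · intro v hv
    obtain ⟨j, hj, rfl⟩ := mem_pathVerts.1 hv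
    by_cases hd : 6 ∣ j
    · exact Or.inr (hB j (by omega) hd)
    · exact Or.inl (hA j (by omega) hd)
  · intro j hj
    have hv : ∀ v ∈ pathEdge q j, v ∉ W' → v ∈ pathVerts g m := by
      intro v hv hv'
      simp only [pathEdge, Finset.mem_image, Finset.mem_range] at hv
      obtain ⟨i, hi4, rfl⟩ := hv
      exact hAm (hA _ (by omega) (fun hd => hv' ((key _ (by omega)).2 hd)))
    have hm : ∀ v, v ∈ pathEdge q j ∩ W' ↔ ∃ i, i ≤ 3 ∧ 6 ∣ (3 * j + i) ∧ v = q (3 * j + i) := by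
      intro v
      simp only [pathEdge, Finset.mem_image, Finset.mem_range, Finset.mem_inter]
      constructor
      · rintro ⟨⟨i, hi4, rfl⟩, hw⟩
        exact ⟨i, by omega, (key _ (by omega)).1 hw, rfl⟩
      · rintro ⟨i, hi4, hd, rfl⟩
        exact ⟨⟨i, by omega, rfl⟩, (key _ (by omega)).2 hd⟩
    rcases Nat.even_or_odd' j with ⟨c, rfl | rfl⟩
    · have : pathEdge q (2 * c) ∩ W' = {q (3 * (2 * c))} := by
        ext v
        rw [hm, Finset.mem_singleton]
        constructor
        · rintro ⟨i, hi4, hd, rfl⟩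
          rw [show i = 0 by omega, add_zero]
        · rintro rfl
          exact ⟨0, by omega, by omega, rfl⟩
      rw [this]
      exact ⟨by simp, by simp, hv⟩
    · have : pathEdge q (2 * c + 1) ∩ W' = {q (3 * (2 * c + 1) + 3)} := by
        ext v
        rw [hm, Finset.mem_singleton]
        constructor
        · rintro ⟨i, hi4, hd, rfl⟩
          rw [show i = 3 by omega]
        · rintro rfl
          exact ⟨3, by omega, by omega, rfl⟩
      rw [this]
      exact ⟨by simp, by simp, hv⟩

/-- Corollary 2.5: if a red loose path P = e₁ … eₙ (n ≥ 2, listed by g) in a 2-colored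
complete 4-uniform hypergraph on Fin l is maximal w.r.t. a set W disjoint from V(P)
with |W| ≥ 4, then there are r ≥ 0, W' ⊆ W and two vertex-disjoint blue loose paths
Q (with s edges, s ≥ 2) and Q' (with s' edges) such that s + s' = n - r, which equals
2(|W'| - 2) if s' ≠ 0 and 2(|W'| - 1) if s' = 0; every edge of Q and Q' meets W' in
exactly one vertex which is an end vertex of that edge, with its remaining vertices on
the truncated path P̄ = e₁ … e_{n-r}; some vertex of e_{n-r} \ e_{n-r-1} lies on
neither Q nor Q'; and, writing x = |W \ W'|: if s' = 0 then x ∈ {1,2} or (x ≥ 3 and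
0 ≤ r ≤ 1), while if s' ≠ 0 then x = 0 or (x ≥ 1 and 0 ≤ r ≤ 1). -/
theorem blue_paths_from_maximal_red_path (l n : ℕ) (hn : 2 ≤ n)
    (col : Finset (Fin l) → Bool) (g : ℕ → Fin l)
    (hP : IsLoosePath4 col true g n)
    (W : Finset (Fin l)) (hWP : ∀ w ∈ W, w ∉ pathVerts g n)
    (hW : 4 ≤ W.card) (hmax : MaximalWrt col g n ↑W) :
    ∃ (r s s' : ℕ) (W' : Finset (Fin l)) (q q' : ℕ → Fin l),
      W' ⊆ W ∧
      IsLoosePath4 col false q s ∧ IsLoosePath4 col false q' s' ∧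
      (s' ≠ 0 → ∀ v ∈ pathVerts q s, v ∉ pathVerts q' s') ∧
      2 ≤ s ∧
      s + s' = n - r ∧
      (s' ≠ 0 → s + s' = 2 * (W'.card - 2)) ∧
      (s' = 0 → s + s' = 2 * (W'.card - 1)) ∧
      (∀ j < s, (pathEdge q j ∩ W') ⊆ {q (3 * j), q (3 * j + 3)} ∧
        (pathEdge q j ∩ W').card = 1 ∧
        ∀ v ∈ pathEdge q j, v ∉ W' → v ∈ pathVerts g (n - r)) ∧
      (∀ j < s', (pathEdge q' j ∩ W') ⊆ {q' (3 * j), q' (3 * j + 3)} ∧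
        (pathEdge q' j ∩ W').card = 1 ∧
        ∀ v ∈ pathEdge q' j, v ∉ W' → v ∈ pathVerts g (n - r)) ∧
      (∃ v ∈ pathEdge g (n - r - 1), v ∉ pathEdge g (n - r - 2) ∧
        v ∉ pathVerts q s ∧ (s' ≠ 0 → v ∉ pathVerts q' s')) ∧
      (s' = 0 → (W \ W').card = 1 ∨ (W \ W').card = 2 ∨
        (3 ≤ (W \ W').card ∧ r ≤ 1)) ∧
      (s' ≠ 0 → (W \ W').card = 0 ∨ (1 ≤ (W \ W').card ∧ r ≤ 1)) := by
  obtain ⟨pos0, A0, hb0, hst0⟩ := start hn hP hWP hmax hW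
  obtain ⟨k, pos, A, hk, hkn, ⟨b1, b2, b3, b4⟩, hst⟩ := reach hP hWP hmax n 1 pos0 A0 (by omega)
    le_rfl (by omega) hb0 (Or.inl hst0)
  have hAW : ∀ v ∈ A, v ∉ W := by
    intro v hv hw
    apply hWP v hw
    obtain ⟨j, hj, he⟩ := mem_pathVerts.1 (b4 hv)
    exact mem_pathVerts.2 ⟨j, by omega, he⟩
  have hgW : g pos ∉ W := fun hw => hWP _ hw (mem_pathVerts.2 ⟨pos, by omega, rfl⟩)
  have hr : n - (n - 2 * k) = 2 * k := by omega
  have hv1 : g pos ∈ pathEdge g (2 * k - 1) := by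
    simp only [pathEdge, Finset.mem_image, Finset.mem_range]
    exact ⟨pos - 3 * (2 * k - 1), by omega, by congr 1; omega⟩
  have hv2 : g pos ∉ pathEdge g (2 * k - 2) := by
    simp only [pathEdge, Finset.mem_image, Finset.mem_range]
    rintro ⟨i, hi, he⟩
    have := hP.1 (Set.mem_Iio.2 (by omega)) (Set.mem_Iio.2 (by omega)) he
    omega
  rcases hst with ⟨B, x, y, hB, hp, hc1, hc2⟩ | ⟨A1, A2, B1, B2, x1, y1, x2, y2, t1, t2, h1, h2, h3,
    h4, h5, h6, h7, h8, h9, p1, p2, hc⟩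
  · have hcard := hp.card
    obtain ⟨q, q1, q2, q3⟩ := hp.unpack (Finset.Subset.refl B) (fun v hv h => hAW v hv (hB h)) b4
    refine ⟨n - 2 * k, 2 * k, 0, B, q, q, hB, q1, ⟨?_, by intro i hi; omega⟩, by simp, by omega,
      by omega, by simp, by omega, ?_, by intro i hi; omega, ⟨g pos, ?_, ?_, ?_, by simp⟩, ?_, by simp⟩
    · intro i hi j hj _
      have := Set.mem_Iio.1 hi
      have := Set.mem_Iio.1 hj
      omega
    · rw [hr]; exact q3
    · rw [hr]; exact hv1
    · rw [hr]; exact hv2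
    · intro hv
      rcases q2 _ hv with h | h
      · exact b3 h
      · exact hgW (hB h)
    · intro _; omega
  · have hcd1 := p1.card
    have hcd2 := p2.card
    have hBW := Finset.union_subset h4 h5
    have hcu : (B1 ∪ B2).card = B1.card + B2.card :=
      Finset.card_union_of_disjoint (Finset.disjoint_left.2 (fun {v} h => h6 v h))
    obtain ⟨q, q1, q2, q3⟩ := p1.unpack (W' := B1 ∪ B2) Finset.subset_union_left
      (fun v hv h => hAW v (h1 hv) (hBW h)) (h1.trans b4)
    obtain ⟨q', q1', q2', q3'⟩ := p2.unpack (W' := B1 ∪ B2) Finset.subset_union_right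
      (fun v hv h => hAW v (h2 hv) (hBW h)) (h2.trans b4)
    refine ⟨n - 2 * k, 2 * t1, 2 * t2, B1 ∪ B2, q, q', hBW, q1, q1', ?_, by omega,
      by omega, by omega, by omega, ?_, ?_, ⟨g pos, ?_, ?_, ?_, ?_⟩, by omega, ?_⟩
    · intro _ v hv hv'
      rcases q2 _ hv with h | h <;> rcases q2' _ hv' with h' | h'
      · exact h3 v h h'
      · exact hAW v (h1 h) (h5 h')
      · exact hAW v (h2 h') (h4 h)
      · exact h6 v h h'
    · rw [hr]; exact q3
    · rw [hr]; exact q3'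
    · rw [hr]; exact hv1
    · rw [hr]; exact hv2
    · intro hv
      rcases q2 _ hv with h | h
      · exact b3 (h1 h)
      · exact hgW (h4 h)
    · intro _ hv
      rcases q2' _ hv with h | h
      · exact b3 (h2 h)
      · exact hgW (h5 h)
    · intro _; omega
end

section
/- Let n ≥ m ≥ 3 with (n,m) ∉ {(3,3), (4,3), (4,4)}, and set t = ⌊(m−1)/2⌋ if n > m and t = ⌊m/2⌋ if n = m. Suppose the 4-element subsets of a set of 3n + t vertices are colored red and blue so that there is no red copy of the 4-uniform loose cycle C^4_n. If there is a red copy of C^4_{n−1}, then there is a blue copy of C^4_m. -/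
/-- A copy of the `k`-uniform loose path with `n` edges, all of color `b`
(`true` = red, `false` = blue), in the coloring `col` of the `k`-subsets of `V`.
The path is given by an injective listing `f 0, f 1, …, f (n*(k-1))` of its
vertices, with `i`-th edge `{f (i*(k-1)), …, f (i*(k-1)+k-1)}`. -/
def HasLoosePath {V : Type*} [DecidableEq V] (k n : ℕ) (col : Finset V → Bool)
    (b : Bool) : Prop :=
  ∃ f : ℕ → V, Set.InjOn f (Set.Iio (n * (k - 1) + 1)) ∧
    ∀ i < n, col ((Finset.range k).image fun j => f (i * (k - 1) + j)) = b

/-- A copy of the `k`-uniform loose cycle with `n` edges, all of color `b`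
(`true` = red, `false` = blue), in the coloring `col` of the `k`-subsets of `V`.
The cycle is given by an injective listing `f 0, …, f (n*(k-1) - 1)` of its
vertices, with `i`-th edge `{f (i*(k-1) % (n*(k-1))), …, f ((i*(k-1)+k-1) % (n*(k-1)))}`. -/
def HasLooseCycle {V : Type*} [DecidableEq V] (k n : ℕ) (col : Finset V → Bool)
    (b : Bool) : Prop :=
  ∃ f : ℕ → V, Set.InjOn f (Set.Iio (n * (k - 1))) ∧
    ∀ i < n, col ((Finset.range k).image fun j => f ((i * (k - 1) + j) % (n * (k - 1)))) = b

/-- `R(P^k_n, P^k_m)`: the least positive `N` such that every red-blue coloring of the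
`k`-subsets of an `N`-set contains a red `P^k_n` or a blue `P^k_m`. -/
noncomputable def RamseyPP (k n m : ℕ) : ℕ :=
  sInf {N | 0 < N ∧ ∀ col : Finset (Fin N) → Bool,
    HasLoosePath k n col true ∨ HasLoosePath k m col false}

/-- `R(P^k_n, C^k_m)`. -/
noncomputable def RamseyPC (k n m : ℕ) : ℕ :=
  sInf {N | 0 < N ∧ ∀ col : Finset (Fin N) → Bool,
    HasLoosePath k n col true ∨ HasLooseCycle k m col false}

/-- `R(C^k_n, P^k_m)`. -/
noncomputable def RamseyCP (k n m : ℕ) : ℕ :=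
  sInf {N | 0 < N ∧ ∀ col : Finset (Fin N) → Bool,
    HasLooseCycle k n col true ∨ HasLoosePath k m col false}

/-- `R(C^k_n, C^k_m)`. -/
noncomputable def RamseyCC (k n m : ℕ) : ℕ :=
  sInf {N | 0 < N ∧ ∀ col : Finset (Fin N) → Bool,
    HasLooseCycle k n col true ∨ HasLooseCycle k m col false}

namespace LC

variable {V : Type*} [DecidableEq V]

/-- loose paths with color `c`; all vertices but the last lie in `S`. -/
inductive LP (col : Finset V → Bool) (c : Bool) : ℕ → V → V → Finset V → Prop
  | nil (x : V) (S : Finset V) : LP col c 0 x x S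
  | cons {k : ℕ} {x p q y z : V} {S T : Finset V} (hxp : x ≠ p) (hxq : x ≠ q) (hpq : p ≠ q)
      (hx : x ∉ S) (hp : p ∉ S) (hq : q ∉ S) (hxT : x ∈ T) (hpT : p ∈ T) (hqT : q ∈ T)
      (hST : S ⊆ T) (hc : col {x, p, q, y} = c) (h : LP col c k y z S) : LP col c (k + 1) x z T

variable {col : Finset V → Bool} {c : Bool}

lemma LP.mono {k : ℕ} {x y : V} {S T : Finset V} (h : LP col c k x y S) (hST : S ⊆ T) :
    LP col c k x y T := by
  cases h with
  | nil => exact LP.nil _ _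
  | cons a1 a2 a3 a4 a5 a6 a7 a8 a9 a10 a11 a12 =>
    exact LP.cons a1 a2 a3 a4 a5 a6 (hST a7) (hST a8) (hST a9) (a10.trans hST) a11 a12

lemma LP.comp {k l : ℕ} {x y z : V} {S T : Finset V} (h : LP col c k x y S)
    (h' : LP col c l y z T) (hd : Disjoint S T) : LP col c (k + l) x z (S ∪ T) := by
  induction h with
  | nil x S => simpa using h'.mono Finset.subset_union_right
  | @cons k x p q y' y S S' a1 a2 a3 a4 a5 a6 a7 a8 a9 a10 a11 a12 ih =>
    have := ih h' (Finset.disjoint_of_subset_left a10 hd)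
    rw [show k + 1 + l = (k + l) + 1 by ring]
    have hh : ∀ v ∈ S', v ∉ T := fun v hv => Finset.disjoint_left.1 hd hv
    refine LP.cons a1 a2 a3 (S := S ∪ T) ?_ ?_ ?_ ?_ ?_ ?_ ?_ a11 this
    all_goals first
      | exact Finset.union_subset_union_left a10
      | simp [*]

lemma LP.edge {x p q y : V} {T : Finset V} (hxp : x ≠ p) (hxq : x ≠ q) (hpq : p ≠ q)
    (hxT : x ∈ T) (hpT : p ∈ T) (hqT : q ∈ T) (hc : col {x, p, q, y} = c) :
    LP col c 1 x y T :=
  LP.cons (S := ∅) hxp hxq hpq (by simp) (by simp) (by simp) hxT hpT hqT (by simp) hc (LP.nil _ _)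

lemma LP.toFun {k : ℕ} {x y : V} {S : Finset V} (h : LP col c k x y S) :
    ∃ f : ℕ → V, Set.InjOn f (Set.Iio (3 * k)) ∧ (∀ i < 3 * k, f i ∈ S) ∧ f 0 = x ∧
      f (3 * k) = y ∧ ∀ i < k, col {f (3 * i), f (3 * i + 1), f (3 * i + 2), f (3 * i + 3)} = c := by
  induction h with
  | nil x S => exact ⟨fun _ => x, by simp, by simp, rfl, rfl, by simp⟩
  | @cons k x p q y z S T a1 a2 a3 a4 a5 a6 a7 a8 a9 a10 a11 a12 ih =>
    obtain ⟨f, f1, f2, f3, f4, f5⟩ := ih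
    let g : ℕ → V := fun i => match i with
      | 0 => x
      | 1 => p
      | 2 => q
      | j + 3 => f j
    have n1 : ∀ j < 3 * k, f j ≠ x := fun j hj h => a4 (h ▸ f2 j hj)
    have n2 : ∀ j < 3 * k, f j ≠ p := fun j hj h => a5 (h ▸ f2 j hj)
    have n3 : ∀ j < 3 * k, f j ≠ q := fun j hj h => a6 (h ▸ f2 j hj)
    refine ⟨g, ?_, ?_, rfl, ?_, ?_⟩
    · rintro i hi j hj hij
      simp only [Set.mem_Iio] at hi hj
      match i, j with
      | 0, 0 => rfl
      | 1, 1 => rfl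
      | 2, 2 => rfl
      | 0, 1 => exact absurd hij a1
      | 0, 2 => exact absurd hij a2
      | 1, 2 => exact absurd hij a3
      | 1, 0 => exact absurd hij.symm a1
      | 2, 0 => exact absurd hij.symm a2
      | 2, 1 => exact absurd hij.symm a3
      | 0, j + 3 => exact absurd hij.symm (n1 j (by omega))
      | 1, j + 3 => exact absurd hij.symm (n2 j (by omega))
      | 2, j + 3 => exact absurd hij.symm (n3 j (by omega))
      | i + 3, 0 => exact absurd hij (n1 i (by omega))
      | i + 3, 1 => exact absurd hij (n2 i (by omega))
      | i + 3, 2 => exact absurd hij (n3 i (by omega))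
      | i + 3, j + 3 =>
        have := f1 (show i < 3 * k by omega) (show j < 3 * k by omega) hij
        omega
    · intro i hi
      match i with
      | 0 => exact a7
      | 1 => exact a8
      | 2 => exact a9
      | j + 3 => exact a10 (f2 j (by omega))
    · exact f4
    · intro i hi
      match i with
      | 0 =>
        change col {x, p, q, f 0} = c
        rw [f3]; exact a11
      | j + 1 => exact f5 j (by omega)

lemma LP.cycle {k : ℕ} {x : V} {S : Finset V} (h : LP col c k x x S) :
    HasLooseCycle 4 k col c := by
  obtain ⟨f, f1, f2, f3, f4, f5⟩ := h.toFun
  refine ⟨f, by simpa [mul_comm] using f1, fun i hi => ?_⟩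
  have key : ∀ j < 4, f ((i * (4 - 1) + j) % (k * (4 - 1))) = f (3 * i + j) := by
    intro j hj
    rcases (show 3 * i + j < 3 * k ∨ 3 * i + j = 3 * k by omega) with h | h
    · rw [Nat.mod_eq_of_lt (by omega)]; congr 1; omega
    · rw [show i * (4 - 1) + j = k * (4 - 1) by omega, Nat.mod_self, h, f3, f4]
  rw [← f5 i hi]
  congr 1
  rw [Finset.image_congr (g := fun j => f (3 * i + j)) (fun j hj => key j (by simpa using hj))]
  ext v
  simp [Finset.range_add_one]
  tauto

lemma LP.map {U : Type*} [DecidableEq U] (v : U ↪ V) {k : ℕ} {x y : U} {S : Finset U}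
    (h : LP (fun s => col (s.map v)) c k x y S) : LP col c k (v x) (v y) (S.map v) := by
  induction h with
  | nil x S => exact LP.nil _ _
  | @cons k x p q y z S T a1 a2 a3 a4 a5 a6 a7 a8 a9 a10 a11 a12 ih =>
    refine LP.cons (S := S.map v) ?_ ?_ ?_ ?_ ?_ ?_ ?_ ?_ ?_ ?_ (p := v p) (q := v q) (y := v y) ?_ ih
    all_goals first
      | simpa using a10
      | (simpa using a11)
      | simp [*]

/-- two edges -/
lemma LP.two {x p q y r s z : V} {T : Finset V} (hn : [x, p, q, y, r, s].Nodup)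
    (hT : ∀ v ∈ [x, p, q, y, r, s], v ∈ T)
    (h1 : col {x, p, q, y} = c) (h2 : col {y, r, s, z} = c) : LP col c 2 x z T := by
  simp at hn hT
  refine LP.cons (S := {y, r, s}) ?_ ?_ ?_ ?_ ?_ ?_ ?_ ?_ ?_ ?_ h1
    (LP.edge ?_ ?_ ?_ ?_ ?_ ?_ h2)
  all_goals first
    | simp [hn, hT, Finset.insert_subset_iff]

lemma LP.three {x p q y r s w u v z : V} {T : Finset V} (hn : [x, p, q, y, r, s, w, u, v].Nodup)
    (hT : ∀ i ∈ [x, p, q, y, r, s, w, u, v], i ∈ T)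
    (h1 : col {x, p, q, y} = c) (h2 : col {y, r, s, w} = c) (h3 : col {w, u, v, z} = c) :
    LP col c 3 x z T := by
  have h := LP.two (T := {y, r, s, w, u, v}) (by simp at hn ⊢; simp [hn]) (by simp) h2 h3
  simp at hn hT
  refine LP.cons (S := {y, r, s, w, u, v}) ?_ ?_ ?_ ?_ ?_ ?_ ?_ ?_ ?_ ?_ h1 h
  all_goals first
    | simp [hn, hT, Finset.insert_subset_iff]

lemma no2 {x z : V} {T : Finset V} (H : ¬ LP col c 2 x z T) (p q y r s : V)
    {A B : Finset V} (hA : col A = c) (hB : col B = c)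
    (hn : [x, p, q, y, r, s].Nodup := by decide)
    (hT : ∀ v ∈ [x, p, q, y, r, s], v ∈ T := by decide)
    (eA : A = {x, p, q, y} := by decide) (eB : B = {y, r, s, z} := by decide) : False :=
  H (LP.two hn hT (eA ▸ hA) (eB ▸ hB))

lemma no3 {x z : V} {T : Finset V} (H : ¬ LP col c 3 x z T) (p q y r s w u v : V)
    {A B C : Finset V} (hA : col A = c) (hB : col B = c) (hC : col C = c)
    (hn : [x, p, q, y, r, s, w, u, v].Nodup := by decide)
    (hT : ∀ i ∈ [x, p, q, y, r, s, w, u, v], i ∈ T := by decide)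
    (eA : A = {x, p, q, y} := by decide) (eB : B = {y, r, s, w} := by decide)
    (eC : C = {w, u, v, z} := by decide) : False :=
  H (LP.three hn hT (eA ▸ hA) (eB ▸ hB) (eC ▸ hC))

lemma nt {A : Finset V} (h : col A = true → False) : col A = false :=
  Bool.eq_false_of_not_eq_true h

lemma nf {A : Finset V} (h : col A = false → False) : col A = true :=
  Bool.eq_true_of_not_eq_false h

lemma lemA8 (col : Finset (Fin 8) → Bool) (R : ¬ LP col true 2 0 3 {0, 1, 2, 4, 5, 6, 7}) :
    LP col false 2 4 5 {0, 1, 2, 3, 4, 6, 7} := by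
  by_contra B
  have h1 : col {0, 1, 4, 6} = false := nt fun h1 => by
    have h2 : col {2, 3, 4, 7} = false := nt fun h => no2 R 1 6 4 2 7 h1 h
    have h3 : col {0, 1, 7, 5} = true := nf fun h => no2 B 2 3 7 0 1 h2 h
    have h4 : col {1, 2, 3, 4} = false := nt fun h => no2 R 7 5 1 2 4 h3 h
    have h5 : col {3, 5, 6, 7} = true := nf fun h => no2 B 1 2 3 6 7 h4 h
    exact no2 R 1 4 6 5 7 h1 h5
  have h2 : col {2, 3, 5, 6} = false := nt fun h1 => by
    have h2 : col {0, 1, 5, 7} = false := nt fun h => no2 R 1 7 5 2 6 h h1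
    have h3 : col {2, 3, 4, 7} = true := nf fun h => no2 B 3 2 7 0 1 h h2
    have h4 : col {0, 1, 2, 5} = false := nt fun h => no2 R 1 5 2 7 4 h h3
    have h5 : col {0, 4, 6, 7} = true := nf fun h => no2 B 6 7 0 1 2 h h4
    exact no2 R 4 7 6 2 5 h5 h1
  exact no2 B 0 1 6 2 3 h1 h2

lemma lemA (v : Fin 8 ↪ V)
    (R : ¬ LP col true 2 (v 0) (v 3) (({0, 1, 2, 4, 5, 6, 7} : Finset (Fin 8)).map v)) :
    LP col false 2 (v 4) (v 5) (({0, 1, 2, 3, 4, 6, 7} : Finset (Fin 8)).map v) :=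
  (lemA8 (fun s => col (s.map v)) (fun h => R h.map)).map

/-- list form -/
lemma lemA_list {a b c d s t y z : V} (hn : [a, b, c, d, s, t, y, z].Nodup)
    (R : ¬ LP col true 2 a d {a, b, c, s, t, y, z}) :
    LP col false 2 s t {a, b, c, d, s, y, z} := by
  have := lemA (col := col) ⟨![a, b, c, d, s, t, y, z], by
    rw [← List.nodup_ofFn]; simpa using hn⟩ (by simpa [Finset.map_insert] using R)
  simpa [Finset.map_insert] using this

lemma lemC_aux1 {col : Finset (Fin 12) → Bool}
    (R1 : ¬ LP col true 2 0 3 {0, 1, 2, 7, 8, 9, 10, 11})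
    (B : ¬ LP col false 3 7 8 {0, 1, 2, 3, 4, 5, 6, 7, 9, 10, 11})
    (v o1 o2 p q : Fin 12) {X : Finset (Fin 12)} (e0 : X = {v, p, q, 8} := by decide)
    (e1 : [0, 1, 2, 3, 7, v, o1, o2].Nodup := by decide)
    (e2 : ({0, 1, 2, 7, v, o1, o2} : Finset (Fin 12)) ⊆ {0, 1, 2, 7, 8, 9, 10, 11} := by decide)
    (e3 : v ≠ p := by decide) (e4 : v ≠ q := by decide) (e5 : p ≠ q := by decide)
    (e6 : Disjoint ({0, 1, 2, 3, 7, o1, o2} : Finset (Fin 12)) {v, p, q} := by decide)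
    (e7 : ({0, 1, 2, 3, 7, o1, o2} : Finset (Fin 12)) ∪ {v, p, q} ⊆
      {0, 1, 2, 3, 4, 5, 6, 7, 9, 10, 11} := by decide) : col X = true := by
  subst e0
  refine nf fun h => B ?_
  have h1 : LP col false 2 7 v {0, 1, 2, 3, 7, o1, o2} :=
    lemA_list e1 fun h => R1 (h.mono e2)
  have h2 : LP col false 1 v 8 {v, p, q} := LP.edge e3 e4 e5 (by simp) (by simp) (by simp) h
  exact (h1.comp h2 e6).mono e7

lemma lemC_aux2 {col : Finset (Fin 12) → Bool}
    (R1 : ¬ LP col true 2 3 6 {3, 4, 5, 7, 8, 9, 10, 11})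
    (B : ¬ LP col false 3 7 8 {0, 1, 2, 3, 4, 5, 6, 7, 9, 10, 11})
    (v o1 o2 p q : Fin 12) {X : Finset (Fin 12)} (e0 : X = {7, p, q, v} := by decide)
    (e1 : [3, 4, 5, 6, v, 8, o1, o2].Nodup := by decide)
    (e2 : ({3, 4, 5, v, 8, o1, o2} : Finset (Fin 12)) ⊆ {3, 4, 5, 7, 8, 9, 10, 11} := by decide)
    (e3 : 7 ≠ p := by decide) (e4 : 7 ≠ q := by decide) (e5 : p ≠ q := by decide)
    (e6 : Disjoint ({7, p, q} : Finset (Fin 12)) {3, 4, 5, 6, v, o1, o2} := by decide)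
    (e7 : ({7, p, q} : Finset (Fin 12)) ∪ {3, 4, 5, 6, v, o1, o2} ⊆
      {0, 1, 2, 3, 4, 5, 6, 7, 9, 10, 11} := by decide) : col X = true := by
  subst e0
  refine nf fun h => B ?_
  have h1 : LP col false 2 v 8 {3, 4, 5, 6, v, o1, o2} :=
    lemA_list e1 fun h => R1 (h.mono e2)
  have h2 : LP col false 1 7 v {7, p, q} := LP.edge e3 e4 e5 (by simp) (by simp) (by simp) h
  exact (h2.comp h1 e6).mono e7

lemma lemC12 (col : Finset (Fin 12) → Bool)
    (R1 : ¬ LP col true 2 0 3 {0, 1, 2, 7, 8, 9, 10, 11})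
    (R1' : ¬ LP col true 2 3 6 {3, 4, 5, 7, 8, 9, 10, 11})
    (R2 : ¬ LP col true 3 0 6 {0, 1, 2, 3, 4, 5, 7, 8, 9, 10, 11}) :
    LP col false 3 7 8 {0, 1, 2, 3, 4, 5, 6, 7, 9, 10, 11} := by
  by_contra B
  have a1 : col {10, 5, 6, 8} = true := lemC_aux1 R1 B 10 9 11 5 6
  have a2 : col {8, 11, 4, 6} = true := lemC_aux1 R1 B 11 9 10 4 6
  have a3 : col {11, 5, 8, 6} = true := lemC_aux1 R1 B 11 9 10 5 6
  have b1 : col {0, 2, 11, 7} = true := lemC_aux2 R1' B 11 9 10 0 2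
  have b2 : col {0, 1, 7, 9} = true := lemC_aux2 R1' B 9 10 11 0 1
  have b3 : col {0, 1, 7, 11} = true := lemC_aux2 R1' B 11 9 10 0 1
  have c1 : col {1, 4, 7, 10} = false := nt fun h => no3 R2 2 11 7 1 4 10 5 8 b1 h a1
  have c2 : col {2, 5, 9, 8} = false := nt fun h => no3 R2 1 7 9 2 5 8 11 4 b2 h a2
  have c3 : col {2, 4, 9, 10} = false := nt fun h => no3 R2 1 7 9 2 4 10 5 8 b2 h a1
  have d1 : col {2, 3, 4, 11} = true := nf fun h => no3 B 10 1 4 11 3 2 5 9 c1 h c2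
  have d2 : col {0, 1, 2, 7} = false := nt fun h => no3 R2 1 7 2 3 4 11 5 8 h d1 a3
  have d3 : col {4, 5, 6, 8} = false := nt fun h => no3 R2 1 7 11 2 3 4 5 8 b3 d1 h
  exact no3 B 0 1 2 9 10 4 5 6 d2 c3 d3

lemma lemC_list {a b c d e f g s t x y z : V} (hn : [a, b, c, d, e, f, g, s, t, x, y, z].Nodup)
    (R1 : ¬ LP col true 2 a d {a, b, c, s, t, x, y, z})
    (R1' : ¬ LP col true 2 d g {d, e, f, s, t, x, y, z})
    (R2 : ¬ LP col true 3 a g {a, b, c, d, e, f, s, t, x, y, z}) :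
    LP col false 3 s t {a, b, c, d, e, f, g, s, x, y, z} := by
  let v : Fin 12 ↪ V := ⟨![a, b, c, d, e, f, g, s, t, x, y, z], by
    rw [← List.nodup_ofFn]; simpa using hn⟩
  have := (lemC12 (fun s => col (s.map v)) (fun h => R1 (by simpa [v, Finset.map_insert] using h.map))
    (fun h => R1' (by simpa [v, Finset.map_insert] using h.map))
    (fun h => R2 (by simpa [v, Finset.map_insert] using h.map))).map
  simpa [v, Finset.map_insert] using this

/-- no red path in the homogeneous setting -/
def NoP (col : Finset (Fin 7) → Bool) : Prop := ∀ p q r s u : Fin 7,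
  [0, p, q, r, s, u, 6].Nodup → col {0, p, q} = true → col {q, r, s} = true →
    col {s, u, 6} = true → False

/-- good bowtie -/
def GoodB (col : Finset (Fin 7) → Bool) : Prop := ∃ r p q s u : Fin 7,
  [r, p, q, s, u].Nodup ∧ (∃ m ∈ [(0 : Fin 7), 1, 2], m ∉ [r, p, q, s, u]) ∧
  (∃ m ∈ [(4 : Fin 7), 5, 6], m ∉ [r, p, q, s, u]) ∧ col {r, p, q} = false ∧ col {r, s, u} = false

lemma NoP.ap {col : Finset (Fin 7) → Bool} (H : NoP col) (p q r s u : Fin 7)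
    {A B C : Finset (Fin 7)} (hA : col A = true) (hB : col B = true) (hC : col C = true)
    (hn : [0, p, q, r, s, u, 6].Nodup := by decide) (eA : A = {0, p, q} := by decide)
    (eB : B = {q, r, s} := by decide) (eC : C = {s, u, 6} := by decide) : False :=
  H p q r s u hn (eA ▸ hA) (eB ▸ hB) (eC ▸ hC)

lemma noB {col : Finset (Fin 7) → Bool} (H : ¬ GoodB col) (r p q s u : Fin 7)
    {A B : Finset (Fin 7)} (hA : col A = false) (hB : col B = false)
    (hn : [r, p, q, s, u].Nodup := by decide)
    (h1 : ∃ m ∈ [(0 : Fin 7), 1, 2], m ∉ [r, p, q, s, u] := by decide)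
    (h2 : ∃ m ∈ [(4 : Fin 7), 5, 6], m ∉ [r, p, q, s, u] := by decide)
    (eA : A = {r, p, q} := by decide) (eB : B = {r, s, u} := by decide) : False :=
  H ⟨r, p, q, s, u, hn, h1, h2, eA ▸ hA, eB ▸ hB⟩

lemma lemF (col : Finset (Fin 7) → Bool) (hp : NoP col) (hb : ¬ GoodB col) :
    col {3, 4, 5} = true ∧ col {0, 1, 2} = false ∧ col {0, 1, 4} = false ∧
      col {0, 2, 5} = false := by
  have r013 : col {0, 1, 3} = true := nf fun b013 => by
    have r145 : col {1, 4, 5} = true := nf fun h => noB hb 1 0 3 4 5 b013 h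
    have r345 : col {3, 4, 5} = true := nf fun h => noB hb 3 0 1 4 5 b013 h
    have r346 : col {3, 4, 6} = true := nf fun h => noB hb 3 0 1 4 6 b013 h
    have r156 : col {1, 5, 6} = true := nf fun h => noB hb 1 0 3 5 6 b013 h
    have b023 : col {0, 2, 3} = false := nt fun h => hp.ap 2 3 4 5 1 h r345 r156
    have b025 : col {0, 2, 5} = false := nt fun h => hp.ap 2 5 1 4 3 h r145 r346
    have r034 : col {0, 3, 4} = true := nf fun h => noB hb 0 2 5 3 4 b025 h
    have r256 : col {2, 5, 6} = true := nf fun h => noB hb 2 0 3 5 6 b023 h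
    exact hp.ap 3 4 1 5 2 r034 r145 r256
  have r123 : col {1, 2, 3} = true := nf fun b123 => by
    have r345 : col {3, 4, 5} = true := nf fun h => noB hb 3 1 2 4 5 b123 h
    have r256 : col {2, 5, 6} = true := nf fun h => noB hb 2 1 3 5 6 b123 h
    exact hp.ap 1 3 4 5 2 r013 r345 r256
  have r134 : col {1, 3, 4} = true := nf fun b134 => by
    have r235 : col {2, 3, 5} = true := nf fun h => noB hb 3 1 4 2 5 b134 h
    have r246 : col {2, 4, 6} = true := nf fun h => noB hb 4 1 3 2 6 b134 h
    exact hp.ap 1 3 5 2 4 r013 r235 r246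
  have r345 : col {3, 4, 5} = true := nf fun b345 => by
    have r024 : col {0, 2, 4} = true := nf fun h => noB hb 4 0 2 3 5 h b345
    have r125 : col {1, 2, 5} = true := nf fun h => noB hb 5 1 2 3 4 h b345
    have b246 : col {2, 4, 6} = false := nt fun h => hp.ap 3 1 5 2 4 r013 r125 h
    have b136 : col {1, 3, 6} = false := nt fun h => hp.ap 4 2 5 1 3 r024 r125 h
    exact noB hb 6 1 3 2 4 b136 b246
  have b012 : col {0, 1, 2} = false := nt fun r012 => by
    have b246 : col {2, 4, 6} = false := nt fun h => hp.ap 1 3 5 4 2 r013 r345 h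
    have b356 : col {3, 5, 6} = false := nt fun h => hp.ap 2 1 4 3 5 r012 r134 h
    have r025 : col {0, 2, 5} = true := nf fun h => noB hb 5 0 2 3 6 h b356
    have r136 : col {1, 3, 6} = true := nf fun h => noB hb 6 1 3 2 4 h b246
    exact hp.ap 2 5 4 3 1 r025 r345 r136
  have b014 : col {0, 1, 4} = false := nt fun r014 => by
    have b246 : col {2, 4, 6} = false := nt fun h => hp.ap 1 3 5 4 2 r013 r345 h
    have b236 : col {2, 3, 6} = false := nt fun h => hp.ap 1 4 5 3 2 r014 r345 h
    have r023 : col {0, 2, 3} = true := nf fun h => noB hb 2 0 3 4 6 h b246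
    have r156 : col {1, 5, 6} = true := nf fun h => noB hb 6 1 5 2 3 h b236
    exact hp.ap 2 3 4 1 5 r023 r134 r156
  have b025 : col {0, 2, 5} = false := nt fun r025 => by
    have b136 : col {1, 3, 6} = false := nt fun h => hp.ap 2 5 4 3 1 r025 r345 h
    exact noB hb 1 0 4 3 6 b014 b136
  exact ⟨r345, b012, b014, b025⟩

end LC
namespace LC

variable {V : Type*} [DecidableEq V] {col : Finset V → Bool}

/-- a rich triple -/
def Rich (col : Finset V → Bool) (W T : Finset V) : Prop :=
  3 ≤ (W.filter fun w => col (insert w T) = true).card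

/-- brick -/
def Brick (col : Finset V → Bool) (W S : Finset V) : Prop :=
  ∃ D : Finset V, D.card ≤ 2 ∧ ∀ w ∈ W, ∀ w' ∈ W, w ∉ D → w' ∉ D → w ≠ w' →
    LP col false 2 w w' (insert w S)

lemma exists_D (B B' : Finset V) (hB : B.card ≤ 2) (hB' : B'.card ≤ 2) :
    ∃ D : Finset V, D.card ≤ 2 ∧ ∀ w w', w ∉ D → w' ∉ D → w ≠ w' →
      (w ∉ B ∧ w' ∉ B') ∨ (w' ∉ B ∧ w ∉ B') := by
  rcases (B ∩ B').eq_empty_or_nonempty with h | ⟨x, hx⟩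
  · have hd : ∀ x, x ∈ B → x ∉ B' := fun x h1 h2 => by
      have : x ∈ B ∩ B' := Finset.mem_inter.2 ⟨h1, h2⟩
      simp [h] at this
    rcases B.eq_empty_or_nonempty with h1 | ⟨b, hb⟩
    · subst h1
      exact ⟨B', hB', fun w w' h1 h2 _ => Or.inl ⟨by simp, h2⟩⟩
    rcases B'.eq_empty_or_nonempty with h1 | ⟨b', hb'⟩
    · subst h1
      exact ⟨B, hB, fun w w' h1 h2 _ => Or.inl ⟨h1, by simp⟩⟩
    refine ⟨{b, b'}, Finset.card_le_two, fun w w' h1 h2 h3 => ?_⟩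
    have key : ∀ (C : Finset V) (c : V), C.card ≤ 2 → c ∈ C → w ≠ c → w' ≠ c → ¬ (w ∈ C ∧ w' ∈ C) := by
      intro C c hC hc n1 n2 ⟨m1, m2⟩
      have : ({c, w, w'} : Finset V) ⊆ C := by simp [Finset.insert_subset_iff, *]
      have := Finset.card_le_card this
      rw [Finset.card_eq_three.2 ⟨c, w, w', n1.symm, n2.symm, h3, rfl⟩] at this
      omega
    simp only [Finset.mem_insert, Finset.mem_singleton, not_or] at h1 h2
    have k1 := key B b hB hb h1.1 h2.1
    have k2 := key B' b' hB' hb' h1.2 h2.2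
    have := hd w
    have := hd w'
    tauto
  · refine ⟨B ∩ B', (Finset.card_le_card Finset.inter_subset_left).trans hB, fun w w' h1 h2 h3 => ?_⟩
    have key : ∀ C : Finset V, C.card ≤ 2 → x ∈ C → w ≠ x → w' ≠ x → ¬ (w ∈ C ∧ w' ∈ C) := by
      intro C hC hc n1 n2 ⟨m1, m2⟩
      have : ({x, w, w'} : Finset V) ⊆ C := by simp [Finset.insert_subset_iff, *]
      have := Finset.card_le_card this
      rw [Finset.card_eq_three.2 ⟨x, w, w', n1.symm, n2.symm, h3, rfl⟩] at this
      omega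
    have n1 : w ≠ x := fun h => h1 (h ▸ hx)
    have n2 : w' ≠ x := fun h => h2 (h ▸ hx)
    simp only [Finset.mem_inter] at h1 h2 hx
    have k1 := key B hB hx.1 n1 n2
    have k2 := key B' hB' hx.2 n1 n2
    tauto

lemma brick_of {W : Finset V} {r p q s u : V} (hn : [r, p, q, s, u].Nodup)
    (hW : ∀ x ∈ [r, p, q, s, u], x ∉ W) (h1 : ¬ Rich col W {r, p, q})
    (h2 : ¬ Rich col W {r, s, u}) : Brick col W {r, p, q, s, u} := by
  unfold Rich at h1 h2
  obtain ⟨D, hD, h⟩ := exists_D _ _ (show (W.filter fun w => col (insert w {r, p, q}) = true).card ≤ 2 by omega)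
    (show (W.filter fun w => col (insert w {r, s, u}) = true).card ≤ 2 by omega)
  refine ⟨D, hD, fun w hw w' hw' d d' hne => ?_⟩
  have hx : ∀ x ∈ [r, p, q, s, u], w ≠ x := fun x hx h => hW x hx (h ▸ hw)
  simp at hn hx
  have e1 : ∀ a b c : V, ({w, a, b, c} : Finset V) = {w, c, a, b} := by
    intro a b c; ext; simp; tauto
  have e2 : ∀ a b c : V, ({a, b, c, w'} : Finset V) = {w', a, b, c} := by
    intro a b c; ext; simp; tauto
  rcases h w w' d d' hne with ⟨g1, g2⟩ | ⟨g1, g2⟩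
  · simp [hw, hw'] at g1 g2
    refine LP.two (p := p) (q := q) (y := r) (r := s) (s := u) (by simp [hn, hx]; grind) (by simp)
      (by rw [e1]; exact g1) (by rw [e2]; exact g2)
  · simp [hw, hw'] at g1 g2
    refine LP.two (p := s) (q := u) (y := r) (r := p) (s := q) (by simp [hn, hx]; grind) (by simp)
      (by rw [e1]; exact g2) (by rw [e2]; exact g1)

lemma sdr3 {A B C : Finset V} (hA : 3 ≤ A.card) (hB : 3 ≤ B.card) (hC : 3 ≤ C.card) :
    ∃ a ∈ A, ∃ b ∈ B, ∃ c ∈ C, a ≠ b ∧ a ≠ c ∧ b ≠ c := by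
  obtain ⟨a, ha⟩ := Finset.card_pos.1 (show 0 < A.card by omega)
  obtain ⟨b, hb, hb'⟩ := Finset.exists_mem_notMem_of_card_lt_card
    (show ({a} : Finset V).card < B.card by simp; omega)
  obtain ⟨c, hc, hc'⟩ := Finset.exists_mem_notMem_of_card_lt_card
    (show ({a, b} : Finset V).card < C.card by have := Finset.card_le_two (a := a) (b := b); omega)
  simp at hb' hc'
  exact ⟨a, ha, b, hb, c, hc, by tauto, by tauto, by tauto⟩

open Classical in
lemma window {W : Finset V} (v : Fin 7 ↪ V) (hW : ∀ i, v i ∉ W)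
    (R : ¬ LP col true 3 (v 0) (v 6) (insert (v 0) ({v 1, v 2, v 3, v 4, v 5} ∪ W))) :
    (∃ S, Brick col W S ∧ S ⊆ Finset.univ.map v ∧ (∃ m ∈ [(0 : Fin 7), 1, 2], v m ∉ S) ∧
      (∃ m ∈ [(4 : Fin 7), 5, 6], v m ∉ S)) ∨
    (Rich col W {v 3, v 4, v 5} ∧ ¬ Rich col W {v 0, v 1, v 2} ∧
      ∃ S, Brick col W S ∧ S ⊆ Finset.univ.map v ∧ (∃ m ∈ [(4 : Fin 7), 5, 6], v m ∉ S)) := by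
  let c7 : Finset (Fin 7) → Bool := fun T => decide (Rich col W (T.map v))
  have hinj := v.injective
  have hS : ∀ r p q s u : Fin 7, ({v r, v p, v q, v s, v u} : Finset V) ⊆ Finset.univ.map v := by
    intro r p q s u; simp [Finset.insert_subset_iff]
  have hbr : ∀ r p q s u : Fin 7, [r, p, q, s, u].Nodup → c7 {r, p, q} = false →
      c7 {r, s, u} = false → Brick col W {v r, v p, v q, v s, v u} := by
    intro r p q s u hn h1 h2
    refine brick_of ?_ ?_ (by simpa [c7] using h1) (by simpa [c7] using h2)
    · have := List.Nodup.map hinj hn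
      simpa using this
    · simp [hW]
  have hmem : ∀ m r p q s u : Fin 7, m ∉ [r, p, q, s, u] →
      v m ∉ ({v r, v p, v q, v s, v u} : Finset V) := by
    intro m r p q s u h
    simpa using h
  by_cases hg : GoodB c7
  · obtain ⟨r, p, q, s, u, hn, ⟨m, hm, hm1⟩, ⟨m', hm', hm1'⟩, h1, h2⟩ := hg
    exact Or.inl ⟨_, hbr r p q s u hn h1 h2, hS _ _ _ _ _, ⟨m, hm, hmem _ _ _ _ _ _ hm1⟩,
      ⟨m', hm', hmem _ _ _ _ _ _ hm1'⟩⟩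
  · right
    have hp : NoP c7 := by
      intro p q r s u hn h1 h2 h3
      simp [c7] at h1 h2 h3
      obtain ⟨a, ha, b, hb, c, hc, n1, n2, n3⟩ := sdr3 h1 h2 h3
      simp only [Finset.mem_filter] at ha hb hc
      have hW' : ∀ w ∈ W, ∀ i, v i ≠ w := fun w hw i h => hW i (h ▸ hw)
      have hW'' : ∀ w ∈ W, ∀ i, w ≠ v i := fun w hw i h => hW i (h ▸ hw)
      have mem : ∀ i : Fin 7, i ≠ 6 → v i ∈ (insert (v 0) ({v 1, v 2, v 3, v 4, v 5} ∪ W)) := by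
        intro i h2
        fin_cases i <;> simp at *
      have memW : ∀ w ∈ W, w ∈ (insert (v 0) ({v 1, v 2, v 3, v 4, v 5} ∪ W)) := by
        intro w hw
        simp [hw]
      simp at hn
      refine R (LP.three (p := a) (q := v p) (y := v q) (r := b) (s := v r) (w := v s) (u := c)
        (v := v u) ?_ ?_ ?_ ?_ ?_)
      · simp [hW' _ ha.1, hW' _ hb.1, hW' _ hc.1, hW'' _ ha.1, hW'' _ hb.1, hW'' _ hc.1, n1, n2, n3, hn]
      · intro i hi
        simp only [List.mem_cons, List.not_mem_nil, or_false] at hi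
        rcases hi with h | h | h | h | h | h | h | h | h <;> subst h <;>
          first
          | exact memW _ ha.1
          | exact memW _ hb.1
          | exact memW _ hc.1
          | exact mem _ (by simp [hn]; done)
      · rw [Finset.insert_comm]; exact ha.2
      · rw [Finset.insert_comm]; exact hb.2
      · rw [Finset.insert_comm]; exact hc.2
    obtain ⟨h1, h2, h3, h4⟩ := lemF c7 hp hg
    refine ⟨by simpa [c7] using h1, by simpa [c7] using h2, _, hbr 0 1 4 2 5 (by decide) h3 h4,
      hS _ _ _ _ _, 6, by simp, hmem _ _ _ _ _ _ (by decide)⟩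

end LC
namespace LC

variable {V : Type*} [DecidableEq V] {col : Finset V → Bool}

/-- periodic parametrization of a red cycle -/
structure Cyc (col : Finset V → Bool) (W : Finset V) (N : ℕ) (F : ℕ → V) : Prop where
  per : ∀ i, F (i + 3 * N) = F i
  inj : ∀ i j, i < j → j < i + 3 * N → F i ≠ F j
  edge : ∀ i, col {F (3 * i), F (3 * i + 1), F (3 * i + 2), F (3 * i + 3)} = true
  notW : ∀ i, F i ∉ W

variable {W : Finset V} {N : ℕ} {F : ℕ → V}

lemma Cyc.ne (h : Cyc col W N F) {i j : ℕ} (h0 : i ≠ j) (h1 : i < j + 3 * N)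
    (h2 : j < i + 3 * N) : F i ≠ F j := by
  rcases lt_or_gt_of_ne h0 with g | g
  · exact h.inj i j g h2
  · exact (h.inj j i g h1).symm

lemma Cyc.shift (h : Cyc col W N F) : Cyc col W N (fun i => F (i + 3)) where
  per i := by rw [show i + 3 * N + 3 = (i + 3) + 3 * N by ring]; exact h.per _
  inj i j h1 h2 := h.inj _ _ (by omega) (by omega)
  edge i := by
    have := h.edge (i + 1)
    rw [show 3 * (i + 1) = 3 * i + 3 by ring] at this
    rw [← this]
  notW i := h.notW _

lemma Cyc.disj (h : Cyc col W N F) {A B : Finset ℕ}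
    (H : ∀ a ∈ A, ∀ b ∈ B, a ≠ b ∧ a < b + 3 * N ∧ b < a + 3 * N) :
    Disjoint (A.image F) (B.image F) := by
  rw [Finset.disjoint_left]
  intro x hx hy
  obtain ⟨a, ha, rfl⟩ := Finset.mem_image.1 hx
  obtain ⟨b, hb, hab⟩ := Finset.mem_image.1 hy
  obtain ⟨h1, h2, h3⟩ := H a ha b hb
  exact h.ne h1 h2 h3 hab.symm

lemma Cyc.arc (h : Cyc col W N F) (k : ℕ) (hk : k ≤ N) (i : ℕ) :
    LP col true k (F (3 * i)) (F (3 * (i + k))) ((Finset.Ico (3 * i) (3 * (i + k))).image F) := by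
  induction k generalizing i with
  | zero => exact LP.nil _ _
  | succ k ih =>
    have h1 := ih (by omega) (i + 1)
    rw [show i + 1 + k = i + (k + 1) by ring] at h1
    have hnot : ∀ j < 3, F (3 * i + j) ∉ (Finset.Ico (3 * (i + 1)) (3 * (i + (k + 1)))).image F := by
      intro j hj hm
      obtain ⟨b, hb, hab⟩ := Finset.mem_image.1 hm
      simp only [Finset.mem_Ico] at hb
      exact h.ne (by omega) (by omega) (by omega) hab
    have hin : ∀ j < 3, F (3 * i + j) ∈ (Finset.Ico (3 * i) (3 * (i + (k + 1)))).image F := by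
      intro j hj
      exact Finset.mem_image_of_mem _ (by simp only [Finset.mem_Ico]; omega)
    refine LP.cons (p := F (3 * i + 1)) (q := F (3 * i + 2)) (h.ne ?_ ?_ ?_) (h.ne ?_ ?_ ?_)
      (h.ne ?_ ?_ ?_) (hnot 0 ?_) (hnot 1 ?_) (hnot 2 ?_) (hin 0 ?_) (hin 1 ?_) (hin 2 ?_)
      (Finset.image_subset_image ?_) (h.edge i) h1
    all_goals first
      | omega
      | (apply Finset.Ico_subset_Ico <;> omega)

lemma Cyc.first (h : Cyc col W N F) (hN : 2 ≤ N) (q e : ℕ) (he : e < 3) :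
    LP col true 1 (F (3 * q + e)) (F (3 * q + 3)) ((Finset.Ico (3 * q) (3 * q + 3)).image F) := by
  have hin : ∀ j < 3, F (3 * q + j) ∈ (Finset.Ico (3 * q) (3 * q + 3)).image F := by
    intro j hj
    exact Finset.mem_image_of_mem _ (by simp only [Finset.mem_Ico]; omega)
  have hE := h.edge q
  have n1 : F (3 * q) ≠ F (3 * q + 1) := h.ne (by omega) (by omega) (by omega)
  have n2 : F (3 * q) ≠ F (3 * q + 2) := h.ne (by omega) (by omega) (by omega)
  have n3 : F (3 * q + 1) ≠ F (3 * q + 2) := h.ne (by omega) (by omega) (by omega)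
  have i0 := hin 0 (by omega)
  have i1 := hin 1 (by omega)
  have i2 := hin 2 (by omega)
  interval_cases e
  · exact LP.edge n1 n2 n3 i0 i1 i2 hE
  · refine LP.edge n1.symm n3 n2 i1 i0 i2 ?_
    rw [Finset.insert_comm]; exact hE
  · refine LP.edge (p := F (3 * q)) (q := F (3 * q + 1)) n2.symm n3.symm n1 i2 i0 i1 ?_
    rw [Finset.insert_comm, Finset.insert_comm (F (3 * q + 2))]; exact hE

lemma Cyc.last (h : Cyc col W N F) (hN : 2 ≤ N) (q e : ℕ) (he : e < 3) :
    LP col true 1 (F (3 * q)) (F (3 * q + 1 + e))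
      (((Finset.Icc (3 * q) (3 * q + 3)).erase (3 * q + 1 + e)).image F) := by
  have hin : ∀ j < 4, j ≠ 1 + e → F (3 * q + j) ∈
      ((Finset.Icc (3 * q) (3 * q + 3)).erase (3 * q + 1 + e)).image F := by
    intro j hj hj'
    exact Finset.mem_image_of_mem _ (by simp only [Finset.mem_Icc, Finset.mem_erase]; omega)
  have hE := h.edge q
  have n : ∀ i < 4, ∀ j < 4, i ≠ j → F (3 * q + i) ≠ F (3 * q + j) := by
    intro i hi j hj hij
    exact h.ne (by omega) (by omega) (by omega)
  interval_cases e
  · refine LP.edge (p := F (3 * q + 2)) (q := F (3 * q + 3)) (n 0 ?_ 2 ?_ ?_) (n 0 ?_ 3 ?_ ?_)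
      (n 2 ?_ 3 ?_ ?_) (hin 0 ?_ ?_) (hin 2 ?_ ?_) (hin 3 ?_ ?_) ?_
    on_goal 16 => rw [← hE]; congr 1; ext; simp; tauto
    all_goals omega
  · refine LP.edge (p := F (3 * q + 1)) (q := F (3 * q + 3)) (n 0 ?_ 1 ?_ ?_) (n 0 ?_ 3 ?_ ?_)
      (n 1 ?_ 3 ?_ ?_) (hin 0 ?_ ?_) (hin 1 ?_ ?_) (hin 3 ?_ ?_) ?_
    on_goal 16 => rw [← hE]; congr 1; ext; simp; tauto
    all_goals omega
  · refine LP.edge (p := F (3 * q + 1)) (q := F (3 * q + 2)) (n 0 ?_ 1 ?_ ?_) (n 0 ?_ 2 ?_ ?_)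
      (n 1 ?_ 2 ?_ ?_) (hin 0 ?_ ?_) (hin 1 ?_ ?_) (hin 2 ?_ ?_) ?_
    on_goal 16 => rw [← hE]
    all_goals omega

lemma Cyc.NR (h : Cyc col W N F) (hno : ¬ HasLooseCycle 4 (N + 1) col true) (i r e e' : ℕ)
    (hr1 : 1 ≤ r) (hr : r + 2 ≤ N) (he : e < 3) (he' : e' < 3) {a g : V}
    (ha : a = F (3 * (i + N - 1) + 1 + e)) (hg : g = F (3 * (i + r) + e')) :
    ¬ LP col true (r + 1) a g (insert a ((Finset.Ioo (3 * i) (3 * (i + r))).image F ∪ W)) := by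
  intro hP
  subst ha hg
  obtain ⟨M, rfl⟩ : ∃ M, N = r + 2 + M := ⟨N - (r + 2), by omega⟩
  have eP : i + (r + 2 + M) - 1 = i + r + 1 + M := by omega
  rw [eP] at hP
  have l1 := h.first (by omega) (i + r) e' he'
  have l2 := h.arc M (by omega) (i + r + 1)
  have l3 := h.last (by omega) (i + r + 1 + M) e he
  rw [show 3 * (i + r + 1) = 3 * (i + r) + 3 by ring] at l2
  have d12 := l1.comp l2 (h.disj (by
    intro a ha b hb
    simp only [Finset.mem_Ico] at ha hb
    omega))
  rw [← Finset.image_union] at d12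
  have d123 := d12.comp l3 (h.disj (by
    intro a ha b hb
    simp only [Finset.mem_Ico, Finset.mem_union, Finset.mem_Icc, Finset.mem_erase] at ha hb
    omega))
  rw [← Finset.image_union] at d123
  have tot := hP.comp d123 (by
    rw [Finset.disjoint_left]
    intro x hx hy
    obtain ⟨b, hb, rfl⟩ := Finset.mem_image.1 hy
    simp only [Finset.mem_Ico, Finset.mem_union, Finset.mem_Icc, Finset.mem_erase,
      Finset.mem_insert, Finset.mem_image, Finset.mem_Ioo] at hx hb
    rcases hx with hx | ⟨c, hc, hx⟩ | hx
    · exact h.ne (by omega) (by omega) (by omega) hx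
    · exact h.ne (by omega) (by omega) (by omega) hx
    · exact h.notW _ hx)
  rw [show r + 1 + (1 + M + 1) = r + 2 + M + 1 by ring] at tot
  exact hno tot.cycle

end LC
namespace LC

variable {V : Type*} [DecidableEq V] {col : Finset V → Bool} {W : Finset V} {N : ℕ} {F : ℕ → V}

lemma Cyc.win (h : Cyc col W N F) (hno : ¬ HasLooseCycle 4 (N + 1) col true) (hN : 4 ≤ N)
    (i e : ℕ) (he : e < 3) {a : V} (ha : a = F (3 * (i + N - 1) + 1 + e)) :
    (∃ S, Brick col W S ∧ S ⊆ insert a ((Finset.Ioc (3 * i) (3 * i + 6)).image F) ∧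
      (a ∉ S ∨ F (3 * i + 1) ∉ S ∨ F (3 * i + 2) ∉ S) ∧ ∃ j < 3, F (3 * i + 4 + j) ∉ S) ∨
    (Rich col W {F (3 * i + 3), F (3 * i + 4), F (3 * i + 5)} ∧
      ¬ Rich col W {a, F (3 * i + 1), F (3 * i + 2)} ∧
      ∃ S, Brick col W S ∧ S ⊆ insert a ((Finset.Ioc (3 * i) (3 * i + 6)).image F) ∧
        ∃ j < 3, F (3 * i + 4 + j) ∉ S) := by
  have hnn : ∀ x ∈ [3 * i + 1, 3 * i + 2, 3 * i + 3, 3 * i + 4, 3 * i + 5, 3 * i + 6],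
      F (3 * (i + N - 1) + 1 + e) ≠ F x := by
    intro x hx
    simp at hx
    exact h.ne (by omega) (by omega) (by omega)
  let v : Fin 7 ↪ V := ⟨![a, F (3 * i + 1), F (3 * i + 2), F (3 * i + 3), F (3 * i + 4),
      F (3 * i + 5), F (3 * i + 6)], by
    rw [← List.nodup_ofFn]
    have : ([3 * (i + N - 1) + 1 + e, 3 * i + 1, 3 * i + 2, 3 * i + 3, 3 * i + 4, 3 * i + 5,
        3 * i + 6].map F).Nodup := by
      refine (List.nodup_map_iff_inj_on ?_).2 ?_
      · simp; omega
      · intro x hx y hy hxy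
        by_contra hne
        simp at hx hy
        exact h.ne hne (by omega) (by omega) hxy
    simpa [ha] using this⟩
  have hvW : ∀ j, v j ∉ W := by
    intro j
    fin_cases j <;> simp [v, h.notW, ha]
  have hsub : Finset.univ.map v ⊆ insert a ((Finset.Ioc (3 * i) (3 * i + 6)).image F) := by
    intro x hx
    obtain ⟨j, -, rfl⟩ := Finset.mem_map.1 hx
    have : ∀ j, 1 ≤ j → j ≤ 6 → F (3 * i + j) ∈ insert a ((Finset.Ioc (3 * i) (3 * i + 6)).image F) :=
      fun j h1 h2 => Finset.mem_insert_of_mem (Finset.mem_image_of_mem _ (by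
        simp only [Finset.mem_Ioc]; omega))
    fin_cases j
    · exact Finset.mem_insert_self _ _
    · exact this 1 (by omega) (by omega)
    · exact this 2 (by omega) (by omega)
    · exact this 3 (by omega) (by omega)
    · exact this 4 (by omega) (by omega)
    · exact this 5 (by omega) (by omega)
    · exact this 6 (by omega) (by omega)
  have hR := h.NR hno i 2 e 0 (by omega) (by omega) he (by omega) ha rfl
  have hw := window (col := col) (W := W) v hvW (fun hh => hR (by
    have hh' := hh.mono (T := insert a ((Finset.Ioo (3 * i) (3 * (i + 2))).image F ∪ W)) (by
      have : ∀ j, 1 ≤ j → j ≤ 5 → F (3 * i + j) ∈ ((Finset.Ioo (3 * i) (3 * (i + 2))).image F) :=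
        fun j h1 h2 => (Finset.mem_image_of_mem _ (by
          simp only [Finset.mem_Ioo]; omega))
      refine Finset.insert_subset_insert _ (Finset.union_subset_union_left ?_)
      intro x hx
      simp only [Finset.mem_insert, Finset.mem_singleton] at hx
      rcases hx with rfl | rfl | rfl | rfl | rfl
      · exact this 1 (by omega) (by omega)
      · exact this 2 (by omega) (by omega)
      · exact this 3 (by omega) (by omega)
      · exact this 4 (by omega) (by omega)
      · exact this 5 (by omega) (by omega))
    exact hh'))
  have conv : ∀ S : Finset V, (∃ m ∈ [(4 : Fin 7), 5, 6], v m ∉ S) →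
      ∃ j < 3, F (3 * i + 4 + j) ∉ S := by
    rintro S ⟨m, hm, hS⟩
    simp only [List.mem_cons, List.not_mem_nil, or_false] at hm
    rcases hm with rfl | rfl | rfl
    · exact ⟨0, by omega, hS⟩
    · exact ⟨1, by omega, hS⟩
    · exact ⟨2, by omega, hS⟩
  rcases hw with ⟨S, hS, hS1, ⟨m, hm, hmS⟩, h2⟩ | ⟨h1, h2, S, hS, hS1, h3⟩
  · refine Or.inl ⟨S, hS, hS1.trans hsub, ?_, conv S h2⟩
    simp only [List.mem_cons, List.not_mem_nil, or_false] at hm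
    rcases hm with rfl | rfl | rfl
    · exact Or.inl hmS
    · exact Or.inr (Or.inl hmS)
    · exact Or.inr (Or.inr hmS)
  · exact Or.inr ⟨h1, h2, S, hS, hS1.trans hsub, conv S h3⟩

lemma Cyc.base (h : Cyc col W N F) (hno : ¬ HasLooseCycle 4 (N + 1) col true) (hN : 4 ≤ N) :
    ∃ F', Cyc col W N F' ∧ ∃ S, Brick col W S ∧ S ⊆ (Finset.Icc 0 6).image F' ∧
      (∃ e < 3, F' e ∉ S) ∧ ∃ e < 3, F' (4 + e) ∉ S := by
  have e0 : ∀ F : ℕ → V, Cyc col W N F → F 0 = F (3 * (0 + N - 1) + 1 + 2) := by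
    intro F h
    rw [← h.per 0]; congr 1; omega
  have hs : ∀ F : ℕ → V, insert (F 0) ((Finset.Ioc (3 * 0) (3 * 0 + 6)).image F) ⊆
      (Finset.Icc 0 6).image F := by
    intro F
    rw [← Finset.image_insert]
    exact Finset.image_subset_image (by decide)
  have he : ∀ (F : ℕ → V) (S : Finset V), (F 0 ∉ S ∨ F (3 * 0 + 1) ∉ S ∨ F (3 * 0 + 2) ∉ S) →
      ∃ e < 3, F e ∉ S := by
    rintro F S (h | h | h)
    · exact ⟨0, by omega, h⟩
    · exact ⟨1, by omega, h⟩
    · exact ⟨2, by omega, h⟩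
  rcases h.win hno hN 0 2 (by omega) (e0 F h) with ⟨S, h1, h2, h3, h4⟩ | ⟨hr, -⟩
  · exact ⟨F, h, S, h1, h2.trans (hs F), he F S h3, h4⟩
  · rcases h.shift.win hno hN 0 2 (by omega) (e0 _ h.shift) with ⟨S, h1, h2, h3, h4⟩ | ⟨-, hr', -⟩
    · exact ⟨_, h.shift, S, h1, h2.trans (hs _), he _ S h3, h4⟩
    · exact absurd hr hr'

lemma Cyc.pack (h : Cyc col W N F) (hno : ¬ HasLooseCycle 4 (N + 1) col true) (hN : 4 ≤ N)
    {e0 : ℕ} (he0 : e0 < 3) {S0 : Finset V} (hb : Brick col W S0)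
    (hS0 : S0 ⊆ (Finset.Icc 0 6).image F) (h1 : F e0 ∉ S0) (h2 : ∃ e < 3, F (4 + e) ∉ S0) (k : ℕ)
    (hk : 2 * k + 3 ≤ N) :
    ∃ S : ℕ → Finset V, (∀ j < k + 1, Brick col W (S j)) ∧
      (∀ i < k + 1, ∀ j < k + 1, i ≠ j → Disjoint (S i) (S j)) ∧
      (∀ j < k + 1, S j ⊆ (Finset.Icc 0 (6 * k + 6)).image F) ∧
      (∀ j < k + 1, F e0 ∉ S j) ∧ ∃ e < 3, ∀ j < k + 1, F (6 * k + 4 + e) ∉ S j := by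
  induction k with
  | zero =>
    obtain ⟨e, he, h2⟩ := h2
    refine ⟨fun _ => S0, fun _ _ => hb, fun i hi j hj hij => ?_, fun _ _ => hS0, fun _ _ => h1,
      e, he, fun _ _ => ?_⟩
    · omega
    · simpa using h2
  | succ k ih =>
    obtain ⟨S, a1, a2, a3, a4, e, he, a5⟩ := ih (by omega)
    have ha : F (6 * k + 4 + e) = F (3 * (2 * k + 2 + N - 1) + 1 + e) := by
      rw [← h.per]; congr 1; omega
    obtain ⟨T, b1, b2, e', he', b3⟩ : ∃ T, Brick col W T ∧
        T ⊆ insert (F (6 * k + 4 + e)) ((Finset.Ioc (3 * (2 * k + 2)) (3 * (2 * k + 2) + 6)).image F) ∧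
        ∃ j < 3, F (3 * (2 * k + 2) + 4 + j) ∉ T := by
      rcases h.win hno hN (2 * k + 2) e he ha with ⟨T, b1, b2, -, b3⟩ | ⟨-, -, T, b1, b2, b3⟩
      · exact ⟨T, b1, b2, b3⟩
      · exact ⟨T, b1, b2, b3⟩
    have hT : ∀ x ∈ T, x = F (6 * k + 4 + e) ∨ ∃ b, 6 * k + 6 < b ∧ b ≤ 6 * k + 12 ∧ x = F b := by
      intro x hx
      rcases Finset.mem_insert.1 (b2 hx) with h | h
      · exact Or.inl h
      · obtain ⟨b, hb, rfl⟩ := Finset.mem_image.1 h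
        simp only [Finset.mem_Ioc] at hb
        exact Or.inr ⟨b, by omega, by omega, rfl⟩
    have hdis : ∀ j < k + 1, Disjoint (S j) T := by
      intro j hj
      rw [Finset.disjoint_left]
      intro x hx hxT
      rcases hT x hxT with rfl | ⟨b, hb1, hb2, rfl⟩
      · exact a5 j hj hx
      · obtain ⟨c, hc, hcb⟩ := Finset.mem_image.1 (a3 j hj hx)
        simp only [Finset.mem_Icc] at hc
        exact h.ne (by omega) (by omega) (by omega) hcb
    refine ⟨fun j => if j < k + 1 then S j else T, ?_, ?_, ?_, ?_, e', he', ?_⟩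
    · intro j hj
      dsimp only
      split_ifs with g
      · exact a1 j g
      · exact b1
    · intro i hi j hj hij
      dsimp only
      split_ifs with g g' g'
      · exact a2 i g j g' hij
      · exact hdis i g
      · exact (hdis j g').symm
      · omega
    · intro j hj
      dsimp only
      split_ifs with g
      · exact (a3 j g).trans (Finset.image_subset_image (Finset.Icc_subset_Icc le_rfl (by omega)))
      · intro x hx
        rcases hT x hx with rfl | ⟨b, hb1, hb2, rfl⟩
        · exact Finset.mem_image_of_mem _ (by simp only [Finset.mem_Icc]; omega)
        · exact Finset.mem_image_of_mem _ (by simp only [Finset.mem_Icc]; omega)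
    · intro j hj
      dsimp only
      split_ifs with g
      · exact a4 j g
      · intro hx
        rcases hT _ hx with g | ⟨b, hb1, hb2, g⟩
        · exact h.ne (by omega) (by omega) (by omega) g
        · exact h.ne (by omega) (by omega) (by omega) g
    · intro j hj
      dsimp only
      split_ifs with g
      · intro hx
        obtain ⟨c, hc, hcb⟩ := Finset.mem_image.1 (a3 j g hx)
        simp only [Finset.mem_Icc] at hc
        exact h.ne (by omega) (by omega) (by omega) hcb
      · intro hx
        apply b3
        rw [show 3 * (2 * k + 2) + 4 + e' = 6 * (k + 1) + 4 + e' by ring]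
        exact hx

lemma chain {k : ℕ} (hk : 1 ≤ k) (S : ℕ → Finset V) (hb : ∀ j < k, Brick col W (S j))
    (hd : ∀ i < k, ∀ j < k, i ≠ j → Disjoint (S i) (S j)) (hW : ∀ j < k, Disjoint (S j) W)
    (hc : k + 3 ≤ W.card) :
    ∃ w : ℕ → V, (∀ i ≤ k, ∀ j ≤ k, w i = w j → i = j) ∧ (∀ i ≤ k, w i ∈ W) ∧
      LP col false (2 * k) (w 0) (w k) ((Finset.range k).biUnion S ∪ (Finset.range k).image w) := by
  have hb' : ∀ j, ∃ D : Finset V, D.card ≤ 2 ∧ (j < k → ∀ w ∈ W, ∀ w' ∈ W, w ∉ D → w' ∉ D →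
      w ≠ w' → LP col false 2 w w' (insert w (S j))) := by
    intro j
    by_cases hj : j < k
    · obtain ⟨D, h1, h2⟩ := hb j hj
      exact ⟨D, h1, fun _ => h2⟩
    · exact ⟨∅, by simp, fun h => absurd h hj⟩
  choose D hD1 hD2 using hb'
  let t : Fin (k + 1) → Finset V := fun i =>
    W \ ((if (i : ℕ) = 0 then ∅ else D (i - 1)) ∪ (if (i : ℕ) = k then ∅ else D i))
  have hall : ∀ s : Finset (Fin (k + 1)), s.card ≤ (s.biUnion t).card := by
    intro s
    have hcard : ∀ (X Y : Finset V), W.card ≤ (W \ (X ∪ Y)).card + X.card + Y.card := by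
      intro X Y
      have := Finset.le_card_sdiff (X ∪ Y) W
      have := Finset.card_union_le X Y
      omega
    have hs := Finset.card_le_univ s
    simp only [Fintype.card_fin] at hs
    by_cases h0 : ∃ i ∈ s, (i : ℕ) = 0 ∨ (i : ℕ) = k
    · obtain ⟨i, hi, hik⟩ := h0
      have h1 : (t i).card ≤ (s.biUnion t).card := Finset.card_le_card (Finset.subset_biUnion_of_mem t hi)
      have h2 : k + 1 ≤ (t i).card := by
        have := hcard (if (i : ℕ) = 0 then ∅ else D (i - 1)) (if (i : ℕ) = k then ∅ else D i)
        have d1 := hD1 (i - 1)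
        have d2 := hD1 i
        change k + 1 ≤ (W \ _).card
        rcases hik with g | g
        · simp only [g, if_true, Finset.card_empty] at this ⊢
          have : (if 0 = k then (∅ : Finset V) else D 0).card ≤ 2 := by
            split_ifs
            · simp
            · exact hD1 0
          omega
        · have e1 : (if (i : ℕ) = 0 then (∅ : Finset V) else D (i - 1)).card ≤ 2 := by
            split_ifs
            · simp
            · exact d1
          have e2 : (if (i : ℕ) = k then (∅ : Finset V) else D i).card = 0 := by simp [g]
          omega
      omega
    · push Not at h0
      rcases s.eq_empty_or_nonempty with rfl | ⟨i, hi⟩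
      · simp
      have h1 : (t i).card ≤ (s.biUnion t).card := Finset.card_le_card (Finset.subset_biUnion_of_mem t hi)
      have h2 : k - 1 ≤ (t i).card := by
        have := hcard (D (i - 1)) (D i)
        have d1 := hD1 (i - 1)
        have d2 := hD1 i
        have e : t i = W \ (D (i - 1) ∪ D i) := by
          change W \ (_ ∪ _) = _
          rw [if_neg (h0 i hi).1, if_neg (h0 i hi).2]
        rw [e]; omega
      have h3 : s.card ≤ k - 1 := by
        have hsub : s ⊆ (Finset.univ.erase 0).erase (Fin.last k) := by
          intro j hj
          have := h0 j hj
          simp only [Finset.mem_erase, Finset.mem_univ, and_true]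
          constructor
          · intro h; exact this.2 (by simp [h])
          · intro h; exact this.1 (by simp [h])
        have := Finset.card_le_card hsub
        rw [Finset.card_erase_of_mem (by simp [Fin.ext_iff]; omega), Finset.card_erase_of_mem (by simp)] at this
        simpa using this
      omega
  obtain ⟨f, hf1, hf2⟩ := (Finset.all_card_le_biUnion_card_iff_exists_injective t).1 hall
  let w : ℕ → V := fun i => if h : i < k + 1 then f ⟨i, h⟩ else f 0
  have hw : ∀ i (h : i < k + 1), w i = f ⟨i, h⟩ := fun i h => dif_pos h
  have hwi : ∀ i ≤ k, ∀ j ≤ k, w i = w j → i = j := by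
    intro i hi j hj hij
    rw [hw i (by omega), hw j (by omega)] at hij
    simpa using hf1 hij
  have hwm : ∀ i ≤ k, w i ∈ W ∧ (i ≠ 0 → w i ∉ D (i - 1)) ∧ (i ≠ k → w i ∉ D i) := by
    intro i hi
    have := hf2 ⟨i, by omega⟩
    rw [← hw i (by omega)] at this
    simp only [t, Finset.mem_sdiff, Finset.mem_union, not_or] at this
    refine ⟨this.1, fun h => ?_, fun h => ?_⟩
    · simpa [h] using this.2.1
    · simpa [h] using this.2.2
  refine ⟨w, hwi, fun i hi => (hwm i hi).1, ?_⟩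
  have main : ∀ j ≤ k, LP col false (2 * j) (w 0) (w j)
      ((Finset.range j).biUnion S ∪ (Finset.range j).image w) := by
    intro j
    induction j with
    | zero => intro _; exact LP.nil _ _
    | succ j ih =>
      intro hj
      have l1 := ih (by omega)
      have l2 := hD2 j (by omega) (w j) (hwm j (by omega)).1 (w (j + 1)) (hwm (j + 1) hj).1
        ((hwm j (by omega)).2.2 (by omega)) (by simpa using (hwm (j + 1) hj).2.1 (by omega))
        (fun h => by have := hwi _ (by omega) _ hj h; omega)
      refine (l1.comp l2 ?_).mono ?_
      · rw [Finset.disjoint_left]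
        intro x hx hy
        simp only [Finset.mem_union, Finset.mem_biUnion, Finset.mem_range, Finset.mem_image,
          Finset.mem_insert] at hx hy
        rcases hx with ⟨i, hi, hx⟩ | ⟨i, hi, rfl⟩
        · rcases hy with rfl | hy
          · exact Finset.disjoint_left.1 (hW i (by omega)) hx (hwm j (by omega)).1
          · exact Finset.disjoint_left.1 (hd i (by omega) j (by omega) (by omega)) hx hy
        · rcases hy with hy | hy
          · have := hwi _ (by omega) _ (by omega) hy
            omega
          · exact Finset.disjoint_left.1 (hW j (by omega)) hy (hwm i (by omega)).1
      · intro x hx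
        simp only [Finset.mem_union, Finset.mem_biUnion, Finset.mem_range, Finset.mem_image,
          Finset.mem_insert] at hx ⊢
        rcases hx with (⟨i, hi, hx⟩ | ⟨i, hi, rfl⟩) | rfl | hx
        · exact Or.inl ⟨i, by omega, hx⟩
        · exact Or.inr ⟨i, by omega, rfl⟩
        · exact Or.inr ⟨j, by omega, rfl⟩
        · exact Or.inl ⟨j, by omega, hx⟩
  exact main k le_rfl

end LC
namespace LC

variable {V : Type*} [DecidableEq V] {col : Finset V → Bool} {W : Finset V} {N : ℕ} {F : ℕ → V}

lemma Cyc.nodup (h : Cyc col W N F) (l : List ℕ) (ws : List V) (lo : ℕ) (hl : l.Nodup)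
    (hb : ∀ i ∈ l, lo ≤ i ∧ i < lo + 3 * N) (hw : ws.Nodup) (hW : ∀ x ∈ ws, x ∈ W) :
    (l.map F ++ ws).Nodup := by
  rw [List.nodup_append]
  refine ⟨(List.nodup_map_iff_inj_on hl).2 ?_, hw, ?_⟩
  · intro x hx y hy hxy
    by_contra hne
    have := hb x hx
    have := hb y hy
    exact h.ne hne (by omega) (by omega) hxy
  · intro a ha b hb' hab
    obtain ⟨i, -, rfl⟩ := List.mem_map.1 ha
    exact h.notW i (hab ▸ hW b hb')

lemma close_up {K r : ℕ} {S : ℕ → Finset V} {w : ℕ → V} {T : Finset V}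
    (h1 : LP col false (2 * K) (w 0) (w K) ((Finset.range K).biUnion S ∪ (Finset.range K).image w))
    (h2 : LP col false r (w K) (w 0) T) (hS : ∀ j < K, ∀ x ∈ T, x ∉ S j)
    (hw : ∀ j < K, w j ∉ T) : HasLooseCycle 4 (2 * K + r) col false := by
  refine (h1.comp h2 ?_).cycle
  rw [Finset.disjoint_left]
  intro x hx hT
  simp only [Finset.mem_union, Finset.mem_biUnion, Finset.mem_range, Finset.mem_image] at hx
  rcases hx with ⟨j, hj, hx⟩ | ⟨j, hj, rfl⟩
  · exact hS j hj x hT hx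
  · exact hw j hj hT

lemma Cyc.setup (h : Cyc col W N F) (hno : ¬ HasLooseCycle 4 (N + 1) col true) (hN : 4 ≤ N)
    (K r : ℕ) (hK : 1 ≤ K) (hr1 : 1 ≤ r) (hr : 2 * K + r ≤ N) (hc : K + 3 ≤ W.card) :
    ∃ (F : ℕ → V) (S : ℕ → Finset V) (w : ℕ → V) (e e' : ℕ), Cyc col W N F ∧ e < 3 ∧ e' < 3 ∧
      (∀ j < K, S j ⊆ (Finset.Icc 0 (6 * K)).image F) ∧
      (∀ j < K, F (6 * K - 2 + e) ∉ S j) ∧ (∀ j < K, F (3 * (2 * K + r) + e') ∉ S j) ∧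
      (2 * K + r < N → e' = 0) ∧
      (∀ i ≤ K, ∀ j ≤ K, w i = w j → i = j) ∧ (∀ i ≤ K, w i ∈ W) ∧
      LP col false (2 * K) (w 0) (w K) ((Finset.range K).biUnion S ∪ (Finset.range K).image w) := by
  obtain ⟨F, h, S0, b1, b2, ⟨e0, he0, b3⟩, b4⟩ := h.base hno hN
  obtain ⟨k, rfl⟩ : ∃ k, K = k + 1 := ⟨K - 1, by omega⟩
  obtain ⟨S, a1, a2, a3, a4, e, he, a5⟩ := h.pack hno hN he0 b1 b2 b3 b4 k (by omega)
  obtain ⟨w, c1, c2, c3⟩ := chain (W := W) hK S a1 a2 (fun j hj => by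
    rw [Finset.disjoint_left]
    intro x hx
    obtain ⟨i, -, rfl⟩ := Finset.mem_image.1 (a3 j hj hx)
    exact h.notW i) hc
  obtain ⟨e', he', g1, g2⟩ : ∃ e' < 3, (∀ j < k + 1, F (3 * (2 * (k + 1) + r) + e') ∉ S j) ∧
      (2 * (k + 1) + r < N → e' = 0) := by
    by_cases hlt : 2 * (k + 1) + r < N
    · refine ⟨0, by omega, fun j hj hx => ?_, fun _ => rfl⟩
      obtain ⟨i, hi, hi'⟩ := Finset.mem_image.1 (a3 j hj hx)
      simp only [Finset.mem_Icc] at hi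
      exact h.ne (by omega) (by omega) (by omega) hi'
    · refine ⟨e0, he0, fun j hj hx => ?_, fun h => absurd h hlt⟩
      rw [show 3 * (2 * (k + 1) + r) + e0 = e0 + 3 * N by omega, h.per] at hx
      exact a4 j hj hx
  refine ⟨F, S, w, e, e', h, he, he', a3, ?_, g1, g2, c1, c2, c3⟩
  rw [show 6 * (k + 1) - 2 + e = 6 * k + 4 + e by omega]
  exact a5

lemma Cyc.even_case (h : Cyc col W N F) (hno : ¬ HasLooseCycle 4 (N + 1) col true) (hN : 4 ≤ N)
    (K : ℕ) (hK : 1 ≤ K) (hr : 2 * K + 1 ≤ N) (hc : K + 3 ≤ W.card) :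
    HasLooseCycle 4 (2 * K + 2) col false := by
  obtain ⟨F, S, w, e, e', h, he, he', a1, a2, a3, a4, a5, a6, a7⟩ :=
    h.setup hno hN K 1 hK le_rfl hr hc
  have hcard : 1 < (W \ (Finset.range (K + 1)).image w).card := by
    have h1 := Finset.le_card_sdiff ((Finset.range (K + 1)).image w) W
    have h2 : ((Finset.range (K + 1)).image w).card ≤ _ := Finset.card_image_le
    rw [Finset.card_range] at h2
    omega
  obtain ⟨y, hy, z, hz, hyz⟩ := Finset.one_lt_card.1 hcard
  simp only [Finset.mem_sdiff, Finset.mem_image, Finset.mem_range, not_exists, not_and] at hy hz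
  have hw0 : w K ≠ w 0 := fun hh => by have := a5 _ le_rfl _ (by omega) hh; omega
  have hn := h.nodup [6 * K - 2 + e, 6 * K + 1, 6 * K + 2, 3 * (2 * K + 1) + e']
    [w K, w 0, y, z] (6 * K - 2 + e) (by simp; omega) (by
      intro i hi; simp only [List.mem_cons, List.not_mem_nil, or_false] at hi
      have : 2 * K + 1 = N ∨ e' = 0 := by
        rcases Nat.lt_or_ge (2 * K + 1) N with g | g
        · exact Or.inr (a4 g)
        · exact Or.inl (by omega)
      omega) (by
      have := hy.2 K (by omega); have := hy.2 0 (by omega)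
      have := hz.2 K (by omega); have := hz.2 0 (by omega)
      simp; tauto) (by
      intro x hx; simp only [List.mem_cons, List.not_mem_nil, or_false] at hx
      rcases hx with rfl | rfl | rfl | rfl
      · exact a6 _ le_rfl
      · exact a6 _ (by omega)
      · exact hy.1
      · exact hz.1)
  have hR := h.NR hno (2 * K) 1 e e' le_rfl (by omega) he he' (a := F (6 * K - 2 + e))
    (by rw [← h.per]; congr 1; omega) rfl
  have hI : ∀ j, 6 * K < j → j < 6 * K + 3 →
      F j ∈ (Finset.Ioo (3 * (2 * K)) (3 * (2 * K + 1))).image F :=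
    fun j h1 h2 => Finset.mem_image_of_mem _ (by simp only [Finset.mem_Ioo]; omega)
  have hl := lemA_list (col := col) hn (fun hh => hR (hh.mono (by
    intro x hx
    simp only [Finset.mem_insert, Finset.mem_singleton] at hx
    simp only [Finset.mem_insert, Finset.mem_union]
    rcases hx with rfl | rfl | rfl | rfl | rfl | rfl | rfl
    · exact Or.inl rfl
    · exact Or.inr (Or.inl (hI _ (by omega) (by omega)))
    · exact Or.inr (Or.inl (hI _ (by omega) (by omega)))
    · exact Or.inr (Or.inr (a6 _ le_rfl))
    · exact Or.inr (Or.inr (a6 _ (by omega)))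
    · exact Or.inr (Or.inr hy.1)
    · exact Or.inr (Or.inr hz.1))))
  have hFS : ∀ j < K, ∀ i, 6 * K < i → i < 3 * N → F i ∉ S j := by
    intro j hj i h1 h2 hx
    obtain ⟨i', hi, hi'⟩ := Finset.mem_image.1 (a1 j hj hx)
    simp only [Finset.mem_Icc] at hi
    exact h.ne (by omega) (by omega) (by omega) hi'
  have hWS : ∀ j < K, ∀ x ∈ W, x ∉ S j := by
    intro j hj x hx hxS
    obtain ⟨i', hi, rfl⟩ := Finset.mem_image.1 (a1 j hj hxS)
    exact h.notW _ hx
  refine close_up a7 hl ?_ ?_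
  · intro j hj x hx
    simp only [Finset.mem_insert, Finset.mem_singleton] at hx
    rcases hx with rfl | rfl | rfl | rfl | rfl | rfl | rfl
    · exact a2 j hj
    · exact hFS j hj _ (by omega) (by omega)
    · exact hFS j hj _ (by omega) (by omega)
    · exact a3 j hj
    · exact hWS j hj _ (a6 _ le_rfl)
    · exact hWS j hj _ hy.1
    · exact hWS j hj _ hz.1
  · intro j hj hx
    have hwF : ∀ i, w j ≠ F i := fun i hh => h.notW i (hh ▸ a6 j (by omega))
    simp only [Finset.mem_insert, Finset.mem_singleton, hwF, false_or] at hx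
    rcases hx with hx | hx | hx
    · have := a5 _ (by omega) _ le_rfl hx; omega
    · exact hy.2 j (by omega) hx
    · exact hz.2 j (by omega) hx

lemma Cyc.odd_case (h : Cyc col W N F) (hno : ¬ HasLooseCycle 4 (N + 1) col true) (hN : 4 ≤ N)
    (K : ℕ) (hK : 1 ≤ K) (hr : 2 * K + 2 ≤ N) (hc : K + 4 ≤ W.card) :
    HasLooseCycle 4 (2 * K + 3) col false := by
  obtain ⟨F, S, w, e, e', h, he, he', a1, a2, a3, a4, a5, a6, a7⟩ :=
    h.setup hno hN K 2 hK (by omega) hr (by omega)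
  have hcard : 2 < (W \ (Finset.range (K + 1)).image w).card := by
    have h1 := Finset.le_card_sdiff ((Finset.range (K + 1)).image w) W
    have h2 : ((Finset.range (K + 1)).image w).card ≤ _ := Finset.card_image_le
    rw [Finset.card_range] at h2
    omega
  obtain ⟨u, hu, y, hy, z, hz, huy, huz, hyz⟩ := Finset.two_lt_card.1 hcard
  simp only [Finset.mem_sdiff, Finset.mem_image, Finset.mem_range, not_exists, not_and] at hu hy hz
  have hw0 : w K ≠ w 0 := fun hh => by have := a5 _ le_rfl _ (by omega) hh; omega
  have hn := h.nodup [6 * K - 2 + e, 6 * K + 1, 6 * K + 2, 6 * K + 3, 6 * K + 4, 6 * K + 5,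
      3 * (2 * K + 2) + e']
    [w K, w 0, u, y, z] (6 * K - 2 + e) (by simp; omega) (by
      intro i hi; simp only [List.mem_cons, List.not_mem_nil, or_false] at hi
      have : 2 * K + 2 = N ∨ e' = 0 := by
        rcases Nat.lt_or_ge (2 * K + 2) N with g | g
        · exact Or.inr (a4 g)
        · exact Or.inl (by omega)
      omega) (by
      have := hy.2 K (by omega); have := hy.2 0 (by omega)
      have := hz.2 K (by omega); have := hz.2 0 (by omega)
      have := hu.2 K (by omega); have := hu.2 0 (by omega)
      simp; tauto) (by
      intro x hx; simp only [List.mem_cons, List.not_mem_nil, or_false] at hx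
      rcases hx with rfl | rfl | rfl | rfl | rfl
      · exact a6 _ le_rfl
      · exact a6 _ (by omega)
      · exact hu.1
      · exact hy.1
      · exact hz.1)
  have hR1 := h.NR hno (2 * K) 1 e 0 le_rfl (by omega) he (by omega) (a := F (6 * K - 2 + e))
    (g := F (6 * K + 3))
    (by rw [← h.per]; congr 1; omega) (by congr 1; omega)
  have hR1' := h.NR hno (2 * K + 1) 1 2 e' le_rfl (by omega) (by omega) he' (a := F (6 * K + 3))
    (by rw [← h.per]; congr 1; omega) rfl
  have hR2 := h.NR hno (2 * K) 2 e e' (by omega) (by omega) he he' (a := F (6 * K - 2 + e))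
    (by rw [← h.per]; congr 1; omega) rfl
  have hI : ∀ lo hi j, lo < j → j < hi → F j ∈ (Finset.Ioo lo hi).image F :=
    fun lo hi j h1 h2 => Finset.mem_image_of_mem _ (by simp only [Finset.mem_Ioo]; omega)
  have hl := lemC_list (col := col) hn
    (fun hh => hR1 (hh.mono (by
      intro x hx
      simp only [Finset.mem_insert, Finset.mem_singleton] at hx
      simp only [Finset.mem_insert, Finset.mem_union]
      rcases hx with rfl | rfl | rfl | rfl | rfl | rfl | rfl | rfl
      · exact Or.inl rfl
      · exact Or.inr (Or.inl (hI _ _ _ (by omega) (by omega)))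
      · exact Or.inr (Or.inl (hI _ _ _ (by omega) (by omega)))
      · exact Or.inr (Or.inr (a6 _ le_rfl))
      · exact Or.inr (Or.inr (a6 _ (by omega)))
      · exact Or.inr (Or.inr hu.1)
      · exact Or.inr (Or.inr hy.1)
      · exact Or.inr (Or.inr hz.1))))
    (fun hh => hR1' (hh.mono (by
      intro x hx
      simp only [Finset.mem_insert, Finset.mem_singleton] at hx
      simp only [Finset.mem_insert, Finset.mem_union]
      rcases hx with rfl | rfl | rfl | rfl | rfl | rfl | rfl | rfl
      · exact Or.inl rfl
      · exact Or.inr (Or.inl (hI _ _ _ (by omega) (by omega)))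
      · exact Or.inr (Or.inl (hI _ _ _ (by omega) (by omega)))
      · exact Or.inr (Or.inr (a6 _ le_rfl))
      · exact Or.inr (Or.inr (a6 _ (by omega)))
      · exact Or.inr (Or.inr hu.1)
      · exact Or.inr (Or.inr hy.1)
      · exact Or.inr (Or.inr hz.1))))
    (fun hh => hR2 (hh.mono (by
      intro x hx
      simp only [Finset.mem_insert, Finset.mem_singleton] at hx
      simp only [Finset.mem_insert, Finset.mem_union]
      rcases hx with rfl | rfl | rfl | rfl | rfl | rfl | rfl | rfl | rfl | rfl | rfl
      · exact Or.inl rfl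
      · exact Or.inr (Or.inl (hI _ _ _ (by omega) (by omega)))
      · exact Or.inr (Or.inl (hI _ _ _ (by omega) (by omega)))
      · exact Or.inr (Or.inl (hI _ _ _ (by omega) (by omega)))
      · exact Or.inr (Or.inl (hI _ _ _ (by omega) (by omega)))
      · exact Or.inr (Or.inl (hI _ _ _ (by omega) (by omega)))
      · exact Or.inr (Or.inr (a6 _ le_rfl))
      · exact Or.inr (Or.inr (a6 _ (by omega)))
      · exact Or.inr (Or.inr hu.1)
      · exact Or.inr (Or.inr hy.1)
      · exact Or.inr (Or.inr hz.1))))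
  have hFS : ∀ j < K, ∀ i, 6 * K < i → i < 3 * N → F i ∉ S j := by
    intro j hj i h1 h2 hx
    obtain ⟨i', hi, hi'⟩ := Finset.mem_image.1 (a1 j hj hx)
    simp only [Finset.mem_Icc] at hi
    exact h.ne (by omega) (by omega) (by omega) hi'
  have hWS : ∀ j < K, ∀ x ∈ W, x ∉ S j := by
    intro j hj x hx hxS
    obtain ⟨i', hi, rfl⟩ := Finset.mem_image.1 (a1 j hj hxS)
    exact h.notW _ hx
  refine close_up a7 hl ?_ ?_
  · intro j hj x hx
    simp only [Finset.mem_insert, Finset.mem_singleton] at hx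
    rcases hx with rfl | rfl | rfl | rfl | rfl | rfl | rfl | rfl | rfl | rfl | rfl
    · exact a2 j hj
    · exact hFS j hj _ (by omega) (by omega)
    · exact hFS j hj _ (by omega) (by omega)
    · exact hFS j hj _ (by omega) (by omega)
    · exact hFS j hj _ (by omega) (by omega)
    · exact hFS j hj _ (by omega) (by omega)
    · exact a3 j hj
    · exact hWS j hj _ (a6 _ le_rfl)
    · exact hWS j hj _ hu.1
    · exact hWS j hj _ hy.1
    · exact hWS j hj _ hz.1
  · intro j hj hx
    have hwF : ∀ i, w j ≠ F i := fun i hh => h.notW i (hh ▸ a6 j (by omega))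
    simp only [Finset.mem_insert, Finset.mem_singleton, hwF, false_or] at hx
    rcases hx with hx | hx | hx | hx
    · have := a5 _ (by omega) _ le_rfl hx; omega
    · exact hu.2 j (by omega) hx
    · exact hy.2 j (by omega) hx
    · exact hz.2 j (by omega) hx

lemma Cyc.three_case (h : Cyc col W N F) (hno : ¬ HasLooseCycle 4 (N + 1) col true) (hN : 4 ≤ N)
    (hc : 4 ≤ W.card) : HasLooseCycle 4 3 col false := by
  obtain ⟨T, hT, hTc⟩ := Finset.exists_subset_card_eq hc
  obtain ⟨x, y, z, u, hxy, hxz, hxu, hyz, hyu, hzu, rfl⟩ := Finset.card_eq_four.1 hTc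
  simp only [Finset.insert_subset_iff, Finset.singleton_subset_iff] at hT
  obtain ⟨hx, hy, hz, hu⟩ := hT
  have hFW : ∀ i, ∀ v ∈ W, F i ≠ v := fun i v hv hh => h.notW i (hh ▸ hv)
  have hI : ∀ lo hi j, lo < j → j < hi → F j ∈ (Finset.Ioo lo hi).image F :=
    fun lo hi j h1 h2 => Finset.mem_image_of_mem _ (by simp only [Finset.mem_Ioo]; omega)
  -- blue paths of length two inside the third edge
  have key : ∀ s t p q : V, s ∈ W → t ∈ W → p ∈ W → q ∈ W → [s, t, p, q].Nodup →
      LP col false 2 s t {F 6, F 7, F 8, F 9, s, p, q} := by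
    intro s t p q hs ht hp hq hnd
    have hn := h.nodup [6, 7, 8, 9] [s, t, p, q] 6 (by simp) (by
      intro i hi; simp only [List.mem_cons, List.not_mem_nil, or_false] at hi; omega) hnd (by
      intro v hv; simp only [List.mem_cons, List.not_mem_nil, or_false] at hv
      rcases hv with rfl | rfl | rfl | rfl <;> assumption)
    have hR := h.NR hno 2 1 2 0 le_rfl (by omega) (by omega) (by omega) (a := F 6) (g := F 9)
      (by rw [← h.per]; congr 1; omega) rfl
    refine lemA_list (col := col) hn (fun hh => hR (hh.mono ?_))
    intro v hv
    simp only [Finset.mem_insert, Finset.mem_singleton] at hv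
    simp only [Finset.mem_insert, Finset.mem_union]
    rcases hv with rfl | rfl | rfl | rfl | rfl | rfl | rfl
    · exact Or.inl rfl
    · exact Or.inr (Or.inl (hI _ _ _ (by omega) (by omega)))
    · exact Or.inr (Or.inl (hI _ _ _ (by omega) (by omega)))
    · exact Or.inr (Or.inr hs)
    · exact Or.inr (Or.inr ht)
    · exact Or.inr (Or.inr hp)
    · exact Or.inr (Or.inr hq)
  have fin : ∀ i j s t p q : _, i < 4 → j < 4 → i ≠ j → s ∈ W → t ∈ W → p ∈ W → q ∈ W →
      [s, t, p, q].Nodup → col {t, F i, F j, s} = false → HasLooseCycle 4 3 col false := by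
    intro i j s t p q hi hj hij hs ht hp hq hnd hcol
    have l1 := key s t p q hs ht hp hq hnd
    have l2 : LP col false 1 t s {t, F i, F j} :=
      LP.edge (hFW i t ht).symm (hFW j t ht).symm (h.ne hij (by omega) (by omega)) (by simp)
        (by simp) (by simp) hcol
    refine (l1.comp l2 ?_).cycle
    have e1 : ∀ a, 6 ≤ a → a ≤ 9 → F a ≠ F i ∧ F a ≠ F j := fun a h1 h2 =>
      ⟨h.ne (by omega) (by omega) (by omega), h.ne (by omega) (by omega) (by omega)⟩
    rw [Finset.disjoint_left]
    intro v hv hv'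
    simp only [Finset.mem_insert, Finset.mem_singleton] at hv hv'
    simp only [List.nodup_cons, List.mem_cons, List.not_mem_nil, or_false, not_or] at hnd
    have q1 := e1 6 (by omega) (by omega)
    have q2 := e1 7 (by omega) (by omega)
    have q3 := e1 8 (by omega) (by omega)
    have q4 := e1 9 (by omega) (by omega)
    have hWF := hFW
    rcases hv' with rfl | rfl | rfl
    · rcases hv with hv | hv | hv | hv | hv | hv | hv
      · exact hFW _ _ ht hv.symm
      · exact hFW _ _ ht hv.symm
      · exact hFW _ _ ht hv.symm
      · exact hFW _ _ ht hv.symm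
      · exact hnd.1.1 hv.symm
      · exact hnd.2.1.1 hv
      · exact hnd.2.1.2 hv
    · rcases hv with hv | hv | hv | hv | hv | hv | hv
      · exact q1.1 hv.symm
      · exact q2.1 hv.symm
      · exact q3.1 hv.symm
      · exact q4.1 hv.symm
      · exact hFW _ _ hs hv
      · exact hFW _ _ hp hv
      · exact hFW _ _ hq hv
    · rcases hv with hv | hv | hv | hv | hv | hv | hv
      · exact q1.2 hv.symm
      · exact q2.2 hv.symm
      · exact q3.2 hv.symm
      · exact q4.2 hv.symm
      · exact hFW _ _ hs hv
      · exact hFW _ _ hp hv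
      · exact hFW _ _ hq hv
  have n1 : [y, x, z, u].Nodup := by simp; tauto
  have n2 : [z, y, x, u].Nodup := by simp; tauto
  by_cases c1 : col {x, F 0, F 1, y} = false
  · exact fin 0 1 y x z u (by omega) (by omega) (by omega) hy hx hz hu n1 c1
  by_cases c2 : col {y, F 2, F 3, z} = false
  · exact fin 2 3 z y x u (by omega) (by omega) (by omega) hz hy hx hu n2 c2
  exfalso
  simp only [Bool.not_eq_false] at c1 c2
  have hR := h.NR hno 0 1 2 0 le_rfl (by omega) (by omega) (by omega) (a := F 0) (g := F 3)
    (by rw [← h.per]; congr 1; omega) rfl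
  have d1 : col {F 0, F 1, x, y} = true := by
    rw [← c1]; congr 1; ext v; simp only [Finset.mem_insert, Finset.mem_singleton]; tauto
  have d2 : col {y, z, F 2, F 3} = true := by
    rw [← c2]; congr 1; ext v; simp only [Finset.mem_insert, Finset.mem_singleton]; tauto
  have hn := h.nodup [0, 1, 2] [x, y, z] 0 (by simp) (by
      intro i hi; simp only [List.mem_cons, List.not_mem_nil, or_false] at hi; omega)
      (by simp; tauto) (by
      intro v hv; simp only [List.mem_cons, List.not_mem_nil, or_false] at hv
      rcases hv with rfl | rfl | rfl <;> assumption)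
  refine hR (LP.two (p := F 1) (q := x) (y := y) (r := z) (s := F 2) ?_ ?_ d1 d2)
  · refine (List.Perm.nodup_iff ?_).1 hn
    simp only [List.map_cons, List.map_nil, List.cons_append, List.nil_append]
    refine List.Perm.cons _ (List.Perm.cons _ ?_)
    exact (List.perm_append_comm (l₁ := [F 2]) (l₂ := [x, y, z]))
  · intro v hv
    simp only [List.mem_cons, List.not_mem_nil, or_false] at hv
    simp only [Finset.mem_insert, Finset.mem_union]
    rcases hv with rfl | rfl | rfl | rfl | rfl | rfl
    · exact Or.inl rfl
    · exact Or.inr (Or.inl (hI _ _ _ (by omega) (by omega)))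
    · exact Or.inr (Or.inr hx)
    · exact Or.inr (Or.inr hy)
    · exact Or.inr (Or.inr hz)
    · exact Or.inr (Or.inl (hI _ _ _ (by omega) (by omega)))

lemma exists_Cyc [Fintype V] (hN : 4 ≤ N) (hred : HasLooseCycle 4 N col true) :
    ∃ F W, Cyc col W N F ∧ W.card + 3 * N = Fintype.card V := by
  obtain ⟨f, hf, hc⟩ := hred
  simp only [show 4 - 1 = 3 by rfl, Nat.mul_comm N 3] at hf hc
  have hpos : 0 < 3 * N := by omega
  have hinj : ∀ a b, f (a % (3 * N)) = f (b % (3 * N)) → a % (3 * N) = b % (3 * N) := fun a b hab =>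
    hf (Nat.mod_lt _ hpos) (Nat.mod_lt _ hpos) hab
  refine ⟨fun i => f (i % (3 * N)), Finset.univ \ (Finset.range (3 * N)).image f,
    ⟨fun i => by simp, ?_, ?_, ?_⟩, ?_⟩
  · intro i j h1 h2 hij
    have := hinj _ _ hij
    have h3 : (j - i) % (3 * N) = 0 := Nat.sub_mod_eq_zero_of_mod_eq this.symm
    rw [Nat.mod_eq_of_lt (by omega)] at h3
    omega
  · intro i
    have hm : ∀ j, (3 * i + j) % (3 * N) = ((i % N) * 3 + j) % (3 * N) := by
      intro j
      rw [Nat.add_mod, Nat.mul_mod_mul_left, Nat.add_mod ((i % N) * 3), Nat.mul_comm (i % N) 3,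
        Nat.mul_mod_mul_left, Nat.mod_mod]
    rw [← hc (i % N) (Nat.mod_lt _ (by omega))]
    congr 1
    rw [show Finset.range 4 = {0, 1, 2, 3} by rfl]
    simp only [Finset.image_insert, Finset.image_singleton]
    rw [← hm, ← hm, ← hm, ← hm]
    simp
  · intro i
    simp only [Finset.mem_sdiff, Finset.mem_univ, true_and, not_not]
    exact Finset.mem_image_of_mem _ (Finset.mem_range.2 (Nat.mod_lt _ hpos))
  · have h1 : ((Finset.range (3 * N)).image f).card = 3 * N := by
      rw [Finset.card_image_of_injOn, Finset.card_range]
      intro a ha b hb hab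
      exact hf (by simpa using ha) (by simpa using hb) hab
    have h2 := Finset.card_sdiff_add_card_eq_card (Finset.subset_univ ((Finset.range (3 * N)).image f))
    rw [h1] at h2
    rw [h2, Finset.card_univ]

end LC

/-- Lemma 3.1: let n ≥ m ≥ 3 with (n,m) ∉ {(3,3),(4,3),(4,4)}, and let
t = ⌊(m-1)/2⌋ if n > m and t = ⌊m/2⌋ if n = m. If the 4-subsets of a set of 3n + t
vertices are 2-colored with no red copy of C⁴ₙ, and there is a red copy of C⁴_{n-1},
then there is a blue copy of C⁴ₘ. -/
theorem blue_Cm_from_red_C_n_sub_one (n m t : ℕ) (hm : 3 ≤ m) (hnm : m ≤ n)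
    (h33 : (n, m) ≠ (3, 3)) (h43 : (n, m) ≠ (4, 3)) (h44 : (n, m) ≠ (4, 4))
    (ht : t = if m < n then (m - 1) / 2 else m / 2)
    (col : Finset (Fin (3 * n + t)) → Bool)
    (hnored : ¬ HasLooseCycle 4 n col true)
    (hred : HasLooseCycle 4 (n - 1) col true) :
    HasLooseCycle 4 m col false := by
  have hn : 5 ≤ n := by
    by_contra hlt
    have h3 : (n = 3 ∧ m = 3) ∨ (n = 4 ∧ m = 3) ∨ (n = 4 ∧ m = 4) := by omega
    rcases h3 with ⟨rfl, rfl⟩ | ⟨rfl, rfl⟩ | ⟨rfl, rfl⟩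
    · exact h33 rfl
    · exact h43 rfl
    · exact h44 rfl
  obtain ⟨N, rfl⟩ : ∃ N, n = N + 1 := ⟨n - 1, by omega⟩
  rw [Nat.add_sub_cancel] at hred
  obtain ⟨F, W, h, hW⟩ := LC.exists_Cyc (by omega) hred
  rw [Fintype.card_fin] at hW
  have ht' : (m - 1) / 2 ≤ t := by
    rw [ht]; split_ifs <;> omega
  rcases Nat.lt_or_ge m 4 with h4 | h4
  · obtain rfl : m = 3 := by omega
    exact h.three_case hnored (by omega) (by omega)
  rcases Nat.even_or_odd' m with ⟨c, rfl | rfl⟩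
  · obtain ⟨K, rfl⟩ : ∃ K, c = K + 1 := ⟨c - 1, by omega⟩
    exact h.even_case hnored (by omega) K (by omega) (by omega) (by omega)
  · obtain ⟨K, rfl⟩ : ∃ K, c = K + 1 := ⟨c - 1, by omega⟩
    exact h.odd_case hnored (by omega) K (by omega) (by omega) (by omega)
end
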